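/- arXiv:1411.1546 — 4 statements merged into one kernel-verified Lean document; each statement's English description precedes it below -/
import Mathlib

section
/- Let G be a finite two-connected graph (connected, at least three vertices, and no cut vertex). Then every atomic tree decomposition of G has length at most ν(G) · (tw(G) + 1), where ν(G) is the length of a longest geodesic cycle in G. -/
open SimpleGraph
/-- A tree decomposition of a graph `G` with index type `ι`. -/
structure TreeDecomp {V : Type} (G : SimpleGraph V) (ι : Type) where
  tree : SimpleGraph ι
  isTree : tree.IsTree
  bag : ι → Set V
  covers : ∀ v : V, ∃ i, v ∈ bag i
  coversEdge : ∀ ⦃v w : V⦄, G.Adj v w → ∃ i, v ∈ bag i ∧ w ∈ bag i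
  bagConn : ∀ v : V, (tree.induce {i | v ∈ bag i}).Connected

namespace TreeDecomp

variable {V ι : Type} {G : SimpleGraph V}

noncomputable def width (D : TreeDecomp G ι) : ℕ :=
  sSup {n | ∃ i, (D.bag i).ncard = n} - 1

noncomputable def length (D : TreeDecomp G ι) : ℕ :=
  sSup {d | ∃ i x y, x ∈ D.bag i ∧ y ∈ D.bag i ∧ G.dist x y = d}

noncomputable def fatness [Fintype V] (D : TreeDecomp G ι) :
    Fin (Fintype.card V + 1) → ℕ :=
  fun h => {i | (D.bag i).ncard = Fintype.card V - (h : ℕ)}.ncard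

end TreeDecomp

/-- Lexicographic comparison of tuples. -/
def FinLexLE {m : ℕ} (f g : Fin m → ℕ) : Prop :=
  f = g ∨ ∃ k, (∀ j < k, f j = g j) ∧ f k < g k

/-- An atomic tree decomposition: one of lexicographically minimal fatness. -/
def TreeDecomp.IsAtomic {V ι : Type} [Fintype V] {G : SimpleGraph V}
    (D : TreeDecomp G ι) : Prop :=
  ∀ (ι' : Type) (_ : Fintype ι') (D' : TreeDecomp G ι'), FinLexLE D.fatness D'.fatness

noncomputable def treewidth {V : Type} (G : SimpleGraph V) : ℕ :=
  sInf {w | ∃ (ι : Type) (_ : Fintype ι) (D : TreeDecomp G ι), D.width = w}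

noncomputable def treelength {V : Type} (G : SimpleGraph V) : ℕ :=
  sInf {l | ∃ (ι : Type) (_ : Fintype ι) (D : TreeDecomp G ι), D.length = l}

/-- A cycle of `G`: a connected 2-regular subgraph. -/
def IsCycleSubgraph {V : Type} {G : SimpleGraph V} (H : G.Subgraph) : Prop :=
  H.Connected ∧ ∀ v ∈ H.verts, (H.neighborSet v).ncard = 2

/-- A geodesic subgraph: distances within `H` agree with distances in `G`. -/
def IsGeodesicSubgraph {V : Type} {G : SimpleGraph V} (H : G.Subgraph) : Prop :=
  ∀ u v : H.verts, H.coe.dist u v = G.dist (u : V) (v : V)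

/-- `ν(G)`: the length (number of edges) of a longest geodesic cycle of `G`. -/
noncomputable def geodesicCycleSup {V : Type} (G : SimpleGraph V) : ℕ :=
  sSup {m | ∃ H : G.Subgraph, IsCycleSubgraph H ∧ IsGeodesicSubgraph H ∧ H.edgeSet.ncard = m}

/-- Gromov hyperbolicity via the four-point condition. -/
noncomputable def hyperbolicity {V : Type} (G : SimpleGraph V) : ℝ :=
  sInf {δ : ℝ | 0 ≤ δ ∧ ∀ w x y z : V,
    (G.dist w x : ℝ) + (G.dist y z : ℝ) ≤
      max ((G.dist w y : ℝ) + (G.dist x z : ℝ)) ((G.dist w z : ℝ) + (G.dist x y : ℝ)) + 2 * δ}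

/-- Two-connected: connected, at least three vertices, and no cut vertex. -/
def TwoConnected {V : Type} [Fintype V] (G : SimpleGraph V) : Prop :=
  G.Connected ∧ 3 ≤ Fintype.card V ∧ ∀ x : V, (G.induce {y | y ≠ x}).Connected

/-! ### Rooted trees given by a parent function -/

namespace SimpleGraph

variable {ι : Type*} {T : SimpleGraph ι}

lemma IsTree.eq_of_adj_of_dist_le (hT : T.IsTree) {r s a b : ι} (ha : T.Adj a s) (hb : T.Adj b s)
    (hda : T.dist r a ≤ T.dist r s) (hdb : T.dist r b ≤ T.dist r s) : a = b := by
  have key : ∀ c, T.Adj c s → T.dist r c ≤ T.dist r s →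
      ∃ q : T.Walk r s, q.IsPath ∧ q.penultimate = c := by
    intro c hc hd
    obtain ⟨p, hp, hl⟩ := hT.connected.exists_path_of_dist r c
    have hs : s ∉ p.support := by
      intro hs
      classical
      have h1 : T.dist r s ≤ (p.takeUntil s hs).length := dist_le _
      have h2 := p.length_takeUntil_lt_length hs hc.ne'
      omega
    exact ⟨p.concat hc, hp.concat hs hc, by simp⟩
  obtain ⟨p, hp, rfl⟩ := key a ha hda
  obtain ⟨q, hq, rfl⟩ := key b hb hdb
  have := (hT.isAcyclic.subsingleton_path r s).elim ⟨p, hp⟩ ⟨q, hq⟩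
  rw [Subtype.mk.injEq] at this
  rw [this]

lemma Connected.exists_adj_dist_add_one (hT : T.Connected) {r s : ι} (hs : s ≠ r) :
    ∃ a, T.Adj a s ∧ T.dist r a + 1 = T.dist r s := by
  obtain ⟨p, hl⟩ := hT.exists_walk_length_eq_dist s r
  cases p with
  | nil => exact absurd rfl hs
  | @cons _ a _ h p =>
    refine ⟨a, h.symm, ?_⟩
    have h1 : T.dist a r ≤ p.length := dist_le _
    have h2 := hT.dist_triangle (u := s) (v := a) (w := r)
    have h3 := dist_eq_one_iff_adj.2 h
    rw [Walk.length_cons] at hl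
    rw [dist_comm, dist_comm (u := r)]
    omega

lemma IsTree.dist_add_length_le (hT : T.IsTree) {r u c : ι} :
    ∀ {s : ι} (q : T.Walk s u), q.IsPath → c ∉ q.support →
      (∀ a, T.Adj a s → T.dist r a ≤ T.dist r s → a = c) →
      T.dist r s + q.length ≤ T.dist r u := by
  intro s q
  induction q generalizing c with
  | nil => simp
  | @cons s a u h q ih =>
    intro hp hc hmin
    rw [Walk.cons_isPath_iff] at hp
    have hlt : T.dist r s < T.dist r a := by
      by_contra! hle
      apply hc
      rw [← hmin a h.symm hle]
      simp
    have h2 := ih hp.1 hp.2 fun b hb hd => hT.eq_of_adj_of_dist_le hb h hd hlt.le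
    rw [Walk.length_cons]
    omega

/-- Every connected vertex set of a rooted tree has a unique topmost vertex. -/
lemma IsTree.exists_parent (hT : T.IsTree) (r : ι) :
    ∃ p : ι → ι, (∀ s, s ≠ r → T.dist r (p s) + 1 = T.dist r s) ∧
      ∀ U : Set ι, (T.induce U).Connected →
        ∃ m ∈ U, ∀ s ∈ U, s ≠ m → s ≠ r ∧ p s ∈ U := by
  have hex : ∀ s, ∃ a, s ≠ r → T.Adj a s ∧ T.dist r a + 1 = T.dist r s := by
    intro s
    by_cases hs : s = r
    · exact ⟨s, fun h => absurd hs h⟩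
    · obtain ⟨a, ha⟩ := hT.connected.exists_adj_dist_add_one hs
      exact ⟨a, fun _ => ha⟩
  choose p hp using hex
  refine ⟨p, fun s hs => (hp s hs).2, fun U hU => ?_⟩
  have hne : U.Nonempty := Set.nonempty_coe_sort.1 hU.nonempty
  obtain ⟨m, hm, hmin⟩ : ∃ m ∈ U, ∀ s ∈ U, T.dist r m ≤ T.dist r s :=
    ⟨_, Function.argminOn_mem (T.dist r) U hne, fun s hs => Function.argminOn_le (T.dist r) U hs⟩
  refine ⟨m, hm, fun s hs hsm => ?_⟩
  have hsr : s ≠ r := by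
    rintro rfl
    have h0 := hmin s hs
    rw [dist_self, Nat.le_zero, hT.connected.dist_eq_zero_iff] at h0
    exact hsm h0
  refine ⟨hsr, ?_⟩
  by_contra hps
  obtain ⟨q, hq⟩ := (hU.preconnected ⟨s, hs⟩ ⟨m, hm⟩).exists_isPath
  have hq' : (q.map (Embedding.induce U).toHom).IsPath :=
    hq.map Subtype.val_injective
  have hsupp : p s ∉ (q.map (Embedding.induce U).toHom).support := by
    rw [Walk.support_map, List.mem_map]
    rintro ⟨x, -, hx⟩
    exact hps (hx ▸ x.2)
  have hle := hT.dist_add_length_le (r := r) _ hq' hsupp fun a ha hd =>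
    hT.eq_of_adj_of_dist_le ha (hp s hsr).1 hd (by have := (hp s hsr).2; simp; omega)
  have h1 := hmin s hs
  have h2 : q.length ≠ 0 := fun h => hsm (by simpa using Walk.eq_of_length_eq_zero h)
  rw [Walk.length_map] at hle
  change T.dist r s + q.length ≤ T.dist r m at hle
  omega

/-- The graph joining every non-root `s` to its parent `p s`. -/
def parentGraph (r : ι) (p : ι → ι) : SimpleGraph ι :=
  fromRel fun s a => s ≠ r ∧ a = p s

lemma parentGraph_adj {r : ι} {p : ι → ι} {s : ι} (hs : s ≠ r) (hps : p s ≠ s) :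
    (parentGraph r p).Adj s (p s) := by
  rw [parentGraph, fromRel_adj]
  exact ⟨hps.symm, Or.inl ⟨hs, rfl⟩⟩

lemma parentGraph_isTree [Finite ι] {r : ι} {p : ι → ι} {ρ : ι → ℕ}
    (hρ : ∀ s, s ≠ r → ρ (p s) < ρ s) : (parentGraph r p).IsTree := by
  have hps : ∀ s, s ≠ r → p s ≠ s := fun s hs h => by have := hρ s hs; rw [h] at this; omega
  have hreach : ∀ n s, ρ s ≤ n → (parentGraph r p).Reachable s r := by
    intro n
    induction n with
    | zero =>
      intro s hs
      by_cases h : s = r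
      · rw [h]
      · have := hρ s h
        omega
    | succ n ih =>
      intro s hs
      by_cases h : s = r
      · rw [h]
      · exact (parentGraph_adj h (hps s h)).reachable.trans (ih _ (by have := hρ s h; omega))
  have hconn : (parentGraph r p).Connected :=
    { preconnected := fun a b => (hreach _ a le_rfl).trans (hreach _ b le_rfl).symm
      nonempty := ⟨r⟩ }
  refine isTree_iff_connected_and_card.2 ⟨hconn, le_antisymm ?_ ?_⟩
  · have hsub : (parentGraph r p).edgeSet ⊆ (fun s => s(s, p s)) '' {s | s ≠ r} := by
      intro e
      induction e with
      | _ a b =>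
        rw [mem_edgeSet, parentGraph, fromRel_adj]
        rintro ⟨-, ⟨h1, rfl⟩ | ⟨h1, rfl⟩⟩
        · exact ⟨a, h1, rfl⟩
        · exact ⟨b, h1, Sym2.eq_swap⟩
    have h1 := Set.ncard_le_ncard hsub (Set.toFinite _)
    have h2 := Set.ncard_image_le (f := fun s => s(s, p s)) (Set.toFinite {s | s ≠ r})
    have h3 : {s | s ≠ r}.ncard < (Set.univ : Set ι).ncard :=
      Set.ncard_lt_ncard (Set.ssubset_univ_iff.2 fun h => by
        have : r ∈ {s | s ≠ r} := h ▸ Set.mem_univ r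
        exact this rfl) (Set.toFinite _)
    rw [Set.ncard_univ] at h3
    rw [Nat.card_coe_set_eq]
    omega
  · exact hconn.card_vert_le_card_edgeSet_add_one

lemma parentGraph_induce_connected {r : ι} {p : ι → ι} {ρ : ι → ℕ}
    (hρ : ∀ s, s ≠ r → ρ (p s) < ρ s) {U : Set ι} {m : ι} (hm : m ∈ U)
    (hU : ∀ s ∈ U, s ≠ m → s ≠ r ∧ p s ∈ U) : ((parentGraph r p).induce U).Connected := by
  have hreach : ∀ n s, (hs : s ∈ U) → ρ s ≤ n →
      ((parentGraph r p).induce U).Reachable ⟨s, hs⟩ ⟨m, hm⟩ := by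
    intro n
    induction n with
    | zero =>
      intro s hs hn
      by_cases h : s = m
      · subst h; rfl
      · have := hρ s (hU s hs h).1
        omega
    | succ n ih =>
      intro s hs hn
      by_cases h : s = m
      · subst h; rfl
      · obtain ⟨hsr, hps⟩ := hU s hs h
        have hlt := hρ s hsr
        have hadj : ((parentGraph r p).induce U).Adj ⟨s, hs⟩ ⟨p s, hps⟩ :=
          parentGraph_adj hsr fun h : p s = s => by rw [h] at hlt; omega
        exact hadj.reachable.trans (ih _ hps (by omega))
  exact { preconnected := fun a b => (hreach _ a a.2 le_rfl).trans (hreach _ b b.2 le_rfl).symm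
          nonempty := ⟨⟨m, hm⟩⟩ }

end SimpleGraph

/-! ### Splitting an atomic tree decomposition along a separation -/

namespace TreeDecomp

variable {V ι : Type} {G : SimpleGraph V}

/-- The tree decomposition given by a parent function on the index set. -/
def ofParent [Finite ι] (bag : ι → Set V) {r : ι} {p : ι → ι} {ρ : ι → ℕ}
    (hρ : ∀ s, s ≠ r → ρ (p s) < ρ s)
    (htop : ∀ v, ∃ m, v ∈ bag m ∧ ∀ s, v ∈ bag s → s ≠ m → s ≠ r ∧ v ∈ bag (p s))
    (hedge : ∀ ⦃v w : V⦄, G.Adj v w → ∃ i, v ∈ bag i ∧ w ∈ bag i) : TreeDecomp G ι where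
  tree := parentGraph r p
  isTree := parentGraph_isTree hρ
  bag := bag
  covers v := let ⟨m, hm, _⟩ := htop v; ⟨m, hm⟩
  coversEdge := hedge
  bagConn v := let ⟨_, hm, h⟩ := htop v; parentGraph_induce_connected hρ hm h

lemma not_finLexLE [Fintype V] {ι' : Type} {D : TreeDecomp G ι} {D' : TreeDecomp G ι'} {q : ℕ}
    (hq : q ≤ Fintype.card V)
    (hlt : {i | (D'.bag i).ncard = q}.ncard < {i | (D.bag i).ncard = q}.ncard)
    (hle : ∀ m, q ≤ m → {i | (D'.bag i).ncard = m}.ncard ≤ {i | (D.bag i).ncard = m}.ncard) :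
    ¬ FinLexLE D.fatness D'.fatness := by
  have hq' : Fintype.card V - (Fintype.card V - q) = q := by omega
  let j : Fin (Fintype.card V + 1) := ⟨Fintype.card V - q, by omega⟩
  have hj : D'.fatness j < D.fatness j := by
    simpa only [fatness, j, hq'] using hlt
  rintro (h | ⟨k, hk, hkl⟩)
  · rw [h] at hj
    exact lt_irrefl _ hj
  · rcases lt_or_ge j k with hjk | hjk
    · rw [hk j hjk] at hj
      exact lt_irrefl _ hj
    · refine (hle (Fintype.card V - k) ?_).not_gt hkl
      have : (k : ℕ) ≤ Fintype.card V - q := hjk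
      omega

/-- In an atomic tree decomposition, a separation whose separator lies in the bag at `t` splits no
bag, and at most the bag at `t` is contained in its separator. -/
lemma IsAtomic.separation_aux [Fintype V] [Finite ι] {D : TreeDecomp G ι} (hD : D.IsAtomic)
    {A B : Set V} (hcov : ∀ v, v ∈ A ∨ v ∈ B)
    (hedge : ∀ u v, G.Adj u v → (u ∈ A ∧ v ∈ A) ∨ (u ∈ B ∧ v ∈ B))
    {t : ι} (hAB : A ∩ B ⊆ D.bag t) (ht : D.bag t ⊆ B → D.bag t ⊆ A) (s : ι) :
    (D.bag s ⊆ A ∨ D.bag s ⊆ B) ∧ (D.bag s ⊆ A → D.bag s ⊆ B → s = t) := by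
  classical
  obtain ⟨p, hp, hpc⟩ := D.isTree.exists_parent t
  set ρ := D.tree.dist t
  choose top htop hpar using fun v => hpc _ (D.bagConn v)
  simp only [Set.mem_ofPred_eq] at htop hpar
  have htopt : ∀ v, v ∈ D.bag t → top v = t := fun v hv => by
    by_contra h
    exact (hpar v t hv (Ne.symm h)).1 rfl
  -- the side `(s, true)` of a bag is its trace on `A`, the side `(s, false)` its trace on `B`
  let keep : ι × Bool → Prop := fun j =>
    if j.2 then ¬ D.bag j.1 ⊆ B ∨ j.1 = t else ¬ D.bag j.1 ⊆ A
  let J := {j // keep j}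
  let side : Bool → Set V := fun c => if c then A else B
  let bag : J → Set V := fun j => D.bag j.1.1 ∩ side j.1.2
  let root : J := ⟨(t, true), Or.inr rfl⟩
  let par : J → J := fun j =>
    if h : keep (p j.1.1, j.1.2) ∧ j.1.1 ≠ t then ⟨_, h.1⟩ else root
  let rk : J → ℕ := fun j => if j = root then 0 else ρ j.1.1 + 1
  have hrk : ∀ j, j ≠ root → rk (par j) < rk j := by
    intro j hj
    by_cases h : keep (p j.1.1, j.1.2) ∧ j.1.1 ≠ t
    · have h1 := hp _ h.2
      simp only [rk, par, dif_pos h, if_neg hj]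
      split_ifs <;> omega
    · simp [rk, par, dif_neg h, hj]
  have hkeepA : ∀ {s v}, v ∈ D.bag s → v ∉ B → keep (s, true) := fun hv hB =>
    Or.inl fun h => hB (h hv)
  have hkeepB : ∀ {s v}, v ∈ D.bag s → v ∉ A → keep (s, false) := fun {s v} hv hA h =>
    hA (h hv)
  have hbagtop : ∀ v, ∃ m, v ∈ bag m ∧ ∀ j, v ∈ bag j → j ≠ m → j ≠ root ∧ v ∈ bag (par j) := by
    intro v
    by_cases hvB : v ∈ B
    · by_cases hvA : v ∈ A
      · have hvt := hAB ⟨hvA, hvB⟩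
        refine ⟨root, ⟨hvt, hvA⟩, fun j hj hjr => ⟨hjr, ?_⟩⟩
        by_cases h : keep (p j.1.1, j.1.2) ∧ j.1.1 ≠ t
        · simp only [par, dif_pos h, bag]
          exact ⟨(hpar v _ hj.1 (by rw [htopt v hvt]; exact h.2)).2, hj.2⟩
        · simp only [par, dif_neg h]
          exact ⟨hvt, hvA⟩
      · refine ⟨⟨(top v, false), hkeepB (htop v) hvA⟩, ⟨htop v, hvB⟩, ?_⟩
        rintro ⟨⟨s, _ | _⟩, hk⟩ hj hne
        · have hst : s ≠ top v := by rintro rfl; exact hne rfl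
          have h1 := hpar v s hj.1 hst
          have h : keep (p s, false) ∧ s ≠ t := ⟨hkeepB h1.2 hvA, h1.1⟩
          refine ⟨fun h => Bool.false_ne_true (congrArg (fun j : J => j.1.2) h), ?_⟩
          simp only [par, dif_pos h, bag]
          exact ⟨h1.2, hvB⟩
        · exact absurd hj.2 hvA
    · have hvA := (hcov v).resolve_right hvB
      refine ⟨⟨(top v, true), hkeepA (htop v) hvB⟩, ⟨htop v, hvA⟩, ?_⟩
      rintro ⟨⟨s, _ | _⟩, hk⟩ hj hne
      · exact absurd hj.2 hvB
      · have hst : s ≠ top v := by rintro rfl; exact hne rfl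
        have h1 := hpar v s hj.1 hst
        have h : keep (p s, true) ∧ s ≠ t := ⟨hkeepA h1.2 hvB, h1.1⟩
        refine ⟨fun h' => h.2 (congrArg (fun j : J => j.1.1) h'), ?_⟩
        simp only [par, dif_pos h, bag]
        exact ⟨h1.2, hvA⟩
  have hbagedge : ∀ ⦃u v : V⦄, G.Adj u v → ∃ j, u ∈ bag j ∧ v ∈ bag j := by
    intro u v huv
    obtain ⟨s, hu, hv⟩ := D.coversEdge huv
    rcases hedge u v huv with ⟨huA, hvA⟩ | ⟨huB, hvB⟩
    · by_cases h : D.bag s ⊆ B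
      · exact ⟨root, ⟨hAB ⟨huA, h hu⟩, huA⟩, ⟨hAB ⟨hvA, h hv⟩, hvA⟩⟩
      · exact ⟨⟨(s, true), Or.inl h⟩, ⟨hu, huA⟩, ⟨hv, hvA⟩⟩
    · by_cases h : D.bag s ⊆ A
      · exact ⟨root, ⟨hAB ⟨h hu, huB⟩, h hu⟩, ⟨hAB ⟨h hv, hvB⟩, h hv⟩⟩
      · exact ⟨⟨(s, false), h⟩, ⟨hu, huB⟩, ⟨hv, hvB⟩⟩
  let D' : TreeDecomp G J := ofParent bag hrk hbagtop hbagedge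
  by_contra hs
  let bad : Set ι :=
    {s | ¬ ((D.bag s ⊆ A ∨ D.bag s ⊆ B) ∧ (D.bag s ⊆ A → D.bag s ⊆ B → s = t))}
  obtain ⟨s₀, hs₀, hmax⟩ := Set.exists_max_image bad (fun s => (D.bag s).ncard)
    (Set.toFinite _) ⟨s, hs⟩
  have hsub : ∀ j : J, bag j ⊆ D.bag j.1.1 := fun j => Set.inter_subset_left
  have hgood : ∀ j : J, j.1.1 ∉ bad → bag j = D.bag j.1.1 := by
    rintro ⟨⟨s, c⟩, hk⟩ hgood
    simp only [bad, Set.mem_ofPred_eq, not_not] at hgood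
    refine Set.inter_eq_left.2 ?_
    cases c
    · exact hgood.1.resolve_left hk
    · rcases hk with hk | rfl
      · exact hgood.1.resolve_right hk
      · rcases hgood.1 with h | h
        · exact h
        · exact ht h
  have hbig : ∀ j : J, (D.bag s₀).ncard ≤ (bag j).ncard → bag j = D.bag j.1.1 := by
    intro j hj
    by_cases hb : j.1.1 ∈ bad
    · exact Set.eq_of_subset_of_ncard_le (hsub j) ((hmax _ hb).trans hj) (Set.toFinite _)
    · exact hgood j hb
  have hinj : ∀ j k : J, bag j = D.bag j.1.1 → bag k = D.bag k.1.1 → j.1.1 = k.1.1 → j = k := by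
    rintro ⟨⟨s, c⟩, hj⟩ ⟨⟨s', c'⟩, hk⟩ hj' hk' (rfl : s = s')
    have hj'' := Set.inter_eq_left.1 hj'
    have hk'' := Set.inter_eq_left.1 hk'
    cases c <;> cases c'
    · rfl
    · exact absurd hk'' hj
    · exact absurd hj'' hk
    · rfl
  have himg : ∀ m, (D.bag s₀).ncard ≤ m →
      (fun j : J => j.1.1) '' {j | (bag j).ncard = m} ⊆ {i | (D.bag i).ncard = m} := by
    rintro m hm _ ⟨j, rfl, rfl⟩
    show (D.bag j.1.1).ncard = _
    rw [← hbig j hm]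
  have hcard : ∀ m, (D.bag s₀).ncard ≤ m →
      ((fun j : J => j.1.1) '' {j | (bag j).ncard = m}).ncard = {j | (bag j).ncard = m}.ncard := by
    intro m hm
    refine Set.InjOn.ncard_image ?_
    rintro j rfl k hk hjk
    exact hinj j k (hbig j hm) (hbig k (hm.trans hk.ge)) hjk
  refine not_finLexLE (D := D) (D' := D') (q := (D.bag s₀).ncard) ?_ ?_ ?_
    (hD J (Fintype.ofFinite J) D')
  · rw [← Nat.card_eq_fintype_card]
    exact Set.ncard_le_card _
  · change {j | (bag j).ncard = _}.ncard < _
    rw [← hcard _ le_rfl]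
    refine Set.ncard_lt_ncard ((himg _ le_rfl).ssubset_of_ne fun h => ?_) (Set.toFinite _)
    have : s₀ ∈ {i | (D.bag i).ncard = (D.bag s₀).ncard} := rfl
    rw [← h] at this
    obtain ⟨⟨⟨s, c⟩, hk⟩, hj, rfl⟩ := this
    have h1 := Set.inter_eq_left.1 (hbig ⟨(s, c), hk⟩ (le_of_eq hj.symm))
    cases c
    · exact hs₀ ⟨Or.inr h1, fun h => absurd h hk⟩
    · exact hs₀ ⟨Or.inl h1, fun _ hB => hk.resolve_left (not_not.2 hB)⟩
  · intro m hm
    change {j | (bag j).ncard = m}.ncard ≤ _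
    rw [← hcard m hm]
    exact Set.ncard_le_ncard (himg m hm) (Set.toFinite _)

lemma IsAtomic.separation [Fintype V] [Finite ι] {D : TreeDecomp G ι} (hD : D.IsAtomic)
    {A B : Set V} (hcov : ∀ v, v ∈ A ∨ v ∈ B)
    (hedge : ∀ u v, G.Adj u v → (u ∈ A ∧ v ∈ A) ∨ (u ∈ B ∧ v ∈ B))
    {t : ι} (hAB : A ∩ B ⊆ D.bag t) (s : ι) :
    (D.bag s ⊆ A ∨ D.bag s ⊆ B) ∧ (D.bag s ⊆ A → D.bag s ⊆ B → s = t) := by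
  by_cases ht : D.bag t ⊆ B → D.bag t ⊆ A
  · exact hD.separation_aux hcov hedge hAB ht s
  · obtain ⟨h1, h2⟩ := hD.separation_aux (fun v => (hcov v).symm)
      (fun u v h => (hedge u v h).symm) (Set.inter_comm A B ▸ hAB) (fun _ => by tauto) s
    exact ⟨h1.symm, fun hA hB => h2 hB hA⟩

lemma IsAtomic.eq_of_bag_subset [Fintype V] [Finite ι] {D : TreeDecomp G ι} (hD : D.IsAtomic)
    {s t : ι} (h : D.bag s ⊆ D.bag t) : s = t :=
  (hD.separation (A := Set.univ) (B := D.bag s) (fun _ => Or.inl trivial)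
    (fun _ _ _ => Or.inl ⟨trivial, trivial⟩) (Set.inter_subset_right.trans h) s).2
    (Set.subset_univ _) subset_rfl

lemma IsAtomic.ncard_bag_le [Fintype V] [Finite ι] {D : TreeDecomp G ι} (hD : D.IsAtomic) (t : ι) :
    (D.bag t).ncard ≤ treewidth G + 1 := by
  obtain ⟨ι', hι', D', hw⟩ : treewidth G ∈
      {w | ∃ (ι : Type) (_ : Fintype ι) (D : TreeDecomp G ι), D.width = w} :=
    Nat.sInf_mem ⟨_, ι, Fintype.ofFinite ι, D, rfl⟩
  have hle : ∀ i, (D'.bag i).ncard ≤ treewidth G + 1 := by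
    intro i
    have h1 : (D'.bag i).ncard ≤ sSup {n | ∃ i, (D'.bag i).ncard = n} :=
      le_csSup (Set.finite_range fun i => (D'.bag i).ncard).bddAbove ⟨i, rfl⟩
    rw [width] at hw
    omega
  by_contra! hlt
  have hempty : ∀ m, (D.bag t).ncard ≤ m → {i | (D'.bag i).ncard = m} = ∅ := fun m hm =>
    Set.eq_empty_of_forall_notMem fun i (hi : _ = m) => by have := hle i; omega
  refine not_finLexLE (D := D) (D' := D') (q := (D.bag t).ncard) ?_ ?_ ?_ (hD ι' hι' D')
  · rw [← Nat.card_eq_fintype_card]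
    exact Set.ncard_le_card _
  · rw [hempty _ le_rfl, Set.ncard_empty]
    exact (Set.ncard_pos (Set.toFinite _)).2 ⟨t, rfl⟩
  · intro m hm
    simp [hempty m hm]

end TreeDecomp

/-! ### Shortest closed walks of odd weight -/

namespace SimpleGraph.Walk

variable {V : Type} {G : SimpleGraph V} {f : Sym2 V → ZMod 2} {a b c : V}

/-- The sum of the weights of the edges of a walk. -/
def weight (f : Sym2 V → ZMod 2) (p : G.Walk a b) : ZMod 2 := (p.edges.map f).sum

@[simp] lemma weight_nil : (nil : G.Walk a a).weight f = 0 := rfl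

@[simp] lemma weight_cons (h : G.Adj a b) (p : G.Walk b c) :
    (cons h p).weight f = f s(a, b) + p.weight f := by simp [weight]

@[simp] lemma weight_append (p : G.Walk a b) (q : G.Walk b c) :
    (p.append q).weight f = p.weight f + q.weight f := by simp [weight]

@[simp] lemma weight_reverse (p : G.Walk a b) : p.reverse.weight f = p.weight f := by
  simp [weight, List.sum_reverse]

lemma weight_rotate [DecidableEq V] (p : G.Walk a a) (h : b ∈ p.support) :
    (p.rotate b h).weight f = p.weight f :=
  ((p.rotate_edges b h).perm.map f).sum_eq

lemma weight_eq_zero {p : G.Walk a b} (h : ∀ u v, s(u, v) ∈ p.edges → f s(u, v) = 0) :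
    p.weight f = 0 := by
  refine List.sum_eq_zero fun x hx => ?_
  obtain ⟨e, he, rfl⟩ := List.mem_map.1 hx
  induction e with
  | _ u v => exact h u v he

lemma weight_eq_add {g : V → ZMod 2} {p : G.Walk a b}
    (h : ∀ u v, s(u, v) ∈ p.edges → f s(u, v) = g u + g v) : p.weight f = g a + g b := by
  induction p with
  | nil => exact (CharTwo.add_self_eq_zero _).symm
  | @cons a c b hac p ih =>
    rw [weight_cons, ih fun u v huv => h u v (by simp [huv]), h a c (by simp)]
    linear_combination CharTwo.add_self_eq_zero (g c)

lemma eq_split_of_not_isPath (p : G.Walk a b) (hp : ¬ p.IsPath) :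
    ∃ (u : V) (q₁ : G.Walk a u) (c : G.Walk u u) (q₂ : G.Walk u b),
      p = q₁.append (c.append q₂) ∧ 0 < c.length := by
  classical
  induction p with
  | nil => exact absurd IsPath.nil hp
  | @cons a d b h p ih =>
    by_cases hp' : p.IsPath
    · have ha : a ∈ p.support := by
        by_contra ha
        exact hp (hp'.cons ha)
      exact ⟨a, nil, cons h (p.takeUntil a ha), p.dropUntil a ha,
        by rw [nil_append, cons_append, take_spec], by simp⟩
    · obtain ⟨u, q₁, c, q₂, rfl, hc⟩ := ih hp'
      exact ⟨u, cons h q₁, c, q₂, rfl, hc⟩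

/-- A closed walk of odd weight, shortest among all such walks. -/
def IsMinOdd (f : Sym2 V → ZMod 2) (o : G.Walk a a) : Prop :=
  o.weight f = 1 ∧ ∀ (b : V) (c : G.Walk b b), c.weight f = 1 → o.length ≤ c.length

lemma exists_isMinOdd {c : G.Walk a a} (hc : c.weight f = 1) :
    ∃ (b : V) (o : G.Walk b b), o.IsMinOdd f := by
  classical
  have hex : ∃ n, ∃ (b : V) (o : G.Walk b b), o.weight f = 1 ∧ o.length = n := ⟨_, a, c, hc, rfl⟩
  obtain ⟨b, o, ho, hn⟩ := Nat.find_spec hex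
  exact ⟨b, o, ho, fun b' c' hc' => hn ▸ Nat.find_min' hex ⟨b', c', hc', rfl⟩⟩

private lemma zmod_two_eq_one {x y z : ZMod 2} (h : x + y = 1) : x + z = 1 ∨ z + y = 1 := by
  revert x y z; decide


lemma IsMinOdd.rotate [DecidableEq V] {o : G.Walk a a} (ho : o.IsMinOdd f) (h : b ∈ o.support) :
    (o.rotate b h).IsMinOdd f :=
  ⟨by rw [weight_rotate, ho.1], fun d c hc => by rw [length_rotate]; exact ho.2 d c hc⟩

lemma IsMinOdd.isCycle {o : G.Walk a a} (ho : o.IsMinOdd f) : o.IsCycle := by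
  cases o with
  | nil => simpa using ho.1
  | @cons _ b _ h p =>
    rw [cons_isCycle_iff]
    have hp : p.IsPath := by
      by_contra hp
      obtain ⟨u, q₁, c, q₂, rfl, hc⟩ := p.eq_split_of_not_isPath hp
      have h1 : c.weight f + (cons h (q₁.append q₂)).weight f = 1 := by
        rw [← ho.1]
        simp only [weight_cons, weight_append]
        ring
      have h2 := ho.2 u c
      have h3 := ho.2 a (cons h (q₁.append q₂))
      simp only [length_cons, length_append] at h2 h3
      rcases zmod_two_eq_one (z := 0) h1 with h | h
      · have := h2 (by simpa using h)
        omega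
      · have := h3 (by simpa using h)
        omega
    refine ⟨hp, fun he => ?_⟩
    cases p with
    | nil => simp at he
    | @cons _ d _ h' p =>
      rw [cons_isPath_iff] at hp
      rcases List.mem_cons.1 (edges_cons h' p ▸ he) with he | he
      · obtain rfl : d = a := by
          rcases Sym2.eq_iff.1 he with ⟨rfl, -⟩ | ⟨rfl, -⟩
          · exact absurd rfl h.ne
          · rfl
        rw [isPath_iff_nil, ← eq_nil_iff_nil] at hp
        have h1 := ho.1
        rw [hp.1, weight_cons, weight_cons, weight_nil, Sym2.eq_swap, add_zero,
          CharTwo.add_self_eq_zero] at h1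
        exact zero_ne_one h1
      · exact hp.2 (p.snd_mem_support_of_mem_edges he)

/-- The endpoints of a walk in a connected graph split a shortest odd closed walk into two arcs, one
of which is no longer than the walk. -/
lemma IsMinOdd.length_le_of_append {p : G.Walk a b} {q : G.Walk b a}
    (ho : (p.append q).IsMinOdd f) (r : G.Walk a b) :
    p.length ≤ r.length ∨ q.length ≤ r.length := by
  have h1 : p.weight f + q.weight f = 1 := by rw [← weight_append, ho.1]
  have h2 := ho.2 a (p.append r.reverse)
  have h3 := ho.2 a (r.append q)
  simp only [weight_append, weight_reverse, length_append, length_reverse] at h2 h3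
  rcases zmod_two_eq_one (z := r.weight f) h1 with h | h
  · have := h2 h
    omega
  · have := h3 h
    omega

lemma exists_coe_walk (H : G.Subgraph) (p : G.Walk a b) (ha : a ∈ H.verts) (hb : b ∈ H.verts)
    (hp : ∀ e ∈ p.edges, e ∈ H.edgeSet) :
    ∃ q : H.coe.Walk ⟨a, ha⟩ ⟨b, hb⟩, q.length = p.length := by
  induction p with
  | nil => exact ⟨nil, rfl⟩
  | @cons a d b h p ih =>
    have had : H.Adj a d := hp s(a, d) (by simp)
    obtain ⟨q, hq⟩ := ih had.snd_mem hb fun e he => hp e (by simp [he])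
    exact ⟨cons (show H.coe.Adj ⟨a, ha⟩ ⟨d, had.snd_mem⟩ from had) q, by simp [hq]⟩

lemma IsMinOdd.isGeodesicSubgraph {o : G.Walk a a} (ho : o.IsMinOdd f) :
    IsGeodesicSubgraph o.toSubgraph := by
  classical
  rintro ⟨u, hu⟩ ⟨v, hv⟩
  have hu' := (o.mem_verts_toSubgraph).1 hu
  have hv' : v ∈ (o.rotate u hu').support :=
    (o.mem_support_rotate_iff u hu').2 ((o.mem_verts_toSubgraph).1 hv)
  have hconn : o.toSubgraph.coe.Connected := (Subgraph.connected_iff'.1 o.toSubgraph_connected)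
  obtain ⟨r, hr⟩ := hconn.exists_walk_length_eq_dist ⟨u, hu⟩ ⟨v, hv⟩
  have hle : G.dist u v ≤ o.toSubgraph.coe.dist ⟨u, hu⟩ ⟨v, hv⟩ := by
    rw [← hr, ← r.length_map o.toSubgraph.hom]
    exact dist_le _
  refine le_antisymm ?_ hle
  obtain ⟨w, hw⟩ := (r.map o.toSubgraph.hom).reachable.exists_walk_length_eq_dist
  have hedges : ∀ e ∈ (o.rotate u hu').edges, e ∈ o.toSubgraph.edgeSet := fun e he => by
    rw [edgeSet_toSubgraph]
    exact (o.rotate_edges u hu').perm.mem_iff.1 he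
  have hmin := ho.rotate hu'
  rw [← take_spec (o.rotate u hu') hv'] at hmin hedges
  simp only [edges_append, List.mem_append] at hedges
  change _ ≤ G.dist (o.toSubgraph.hom ⟨u, hu⟩) (o.toSubgraph.hom ⟨v, hv⟩)
  rw [← hw]
  rcases hmin.length_le_of_append w with h | h
  · obtain ⟨q, hq⟩ := exists_coe_walk o.toSubgraph _ hu hv fun e he => hedges e (Or.inl he)
    exact (dist_le q).trans (hq.trans_le h)
  · obtain ⟨q, hq⟩ := exists_coe_walk o.toSubgraph _ hv hu fun e he => hedges e (Or.inr he)
    rw [dist_comm]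
    exact (dist_le q).trans (hq.trans_le h)

lemma IsMinOdd.length_le_geodesicCycleSup [Finite V] {o : G.Walk a a} (ho : o.IsMinOdd f) :
    o.length ≤ geodesicCycleSup G := by
  refine le_csSup ⟨Nat.card (Sym2 V), ?_⟩ ⟨o.toSubgraph,
    ⟨o.toSubgraph_connected, fun v hv => ?_⟩, ho.isGeodesicSubgraph, ?_⟩
  · rintro _ ⟨H, -, -, rfl⟩
    exact Set.ncard_le_card _
  · exact ho.isCycle.ncard_neighborSet_toSubgraph_eq_two (o.mem_verts_toSubgraph.1 hv)
  · classical
    rw [edgeSet_toSubgraph, ← length_edges,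
      ← List.toFinset_card_of_nodup ho.isCycle.isTrail.edges_nodup, ← Set.ncard_coe_finset]
    congr 1
    ext e
    simp [Walk.edgeSet]

lemma dist_le_length_of_mem_support {o : G.Walk a a} (hb : b ∈ o.support) (hc : c ∈ o.support) :
    G.dist b c ≤ o.length := by
  classical
  have hc' := (o.mem_support_rotate_iff b hb).2 hc
  rw [← o.length_rotate b hb]
  exact (dist_le _).trans ((o.rotate b hb).length_takeUntil_le_length hc')

end SimpleGraph.Walk

/-! ### Components of the complement of a vertex set -/

namespace SimpleGraph

variable {V : Type} {G : SimpleGraph V} {S : Set V} {u v w : V}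

/-- The vertices reachable from `u` by walks avoiding `S`. -/
def compAvoiding (G : SimpleGraph V) (S : Set V) (u : V) : Set V :=
  {v | ∃ p : G.Walk u v, ∀ z ∈ p.support, z ∉ S}

lemma self_mem_compAvoiding (hu : u ∉ S) : u ∈ G.compAvoiding S u :=
  ⟨Walk.nil, by simpa using hu⟩

lemma notMem_of_mem_compAvoiding (hv : v ∈ G.compAvoiding S u) : v ∉ S :=
  let ⟨p, hp⟩ := hv
  hp v p.end_mem_support

lemma mem_compAvoiding_of_adj (hv : v ∈ G.compAvoiding S u) (h : G.Adj v w) (hw : w ∉ S) :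
    w ∈ G.compAvoiding S u := by
  obtain ⟨p, hp⟩ := hv
  refine ⟨p.concat h, fun z hz => ?_⟩
  rw [Walk.support_concat, List.mem_append, List.mem_singleton] at hz
  rcases hz with hz | rfl
  · exact hp z hz
  · exact hw

lemma exists_walk_of_mem_compAvoiding (hv : v ∈ G.compAvoiding S u)
    (hw : w ∈ G.compAvoiding S u) : ∃ p : G.Walk v w, ∀ z ∈ p.support, z ∉ S := by
  obtain ⟨p, hp⟩ := hv
  obtain ⟨q, hq⟩ := hw
  refine ⟨p.reverse.append q, fun z hz => ?_⟩
  rw [Walk.mem_support_append_iff, Walk.support_reverse, List.mem_reverse] at hz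
  exact hz.elim (hp z) (hq z)

lemma compAvoiding_induction {P : V → Prop} (hu : P u)
    (hP : ∀ v w, P v → G.Adj v w → v ∉ S → w ∉ S → P w) (hv : v ∈ G.compAvoiding S u) : P v := by
  obtain ⟨p, hp⟩ := hv
  induction p with
  | nil => exact hu
  | @cons a b c h p ih =>
    exact ih (hP a b hu h (hp a (by simp)) (hp b (by simp))) fun z hz => hp z (by simp [hz])

/-- If two disjoint connected sets `K` and `L` attach to `S` on both sides of the partition of `S`
into `X` and `S \ X`, and `K` has no other neighbours, then some geodesic cycle meets both sides. -/
lemma exists_dist_le_geodesicCycleSup [Finite V] {K X : Set V}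
    (hKS : Disjoint K S) (hK : ∀ k ∈ K, ∀ v, G.Adj k v → v ∈ K ∨ v ∈ S) (hX : X ⊆ S)
    {x₁ x₂ k₁ k₂ l₁ l₂ : V} (hx₁ : x₁ ∈ X) (hx₂' : x₂ ∉ X) (hk₁ : k₁ ∈ K)
    (hl₁ : l₁ ∉ K) (hxk₁ : G.Adj x₁ k₁) (hxk₂ : G.Adj x₂ k₂) (hxl₁ : G.Adj x₁ l₁)
    (hxl₂ : G.Adj x₂ l₂)
    {p : G.Walk k₁ k₂} (hp : ∀ z ∈ p.support, z ∉ S)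
    {q : G.Walk l₂ l₁} (hq : ∀ z ∈ q.support, z ∉ S) :
    ∃ y₁ ∈ X, ∃ y₂ ∈ S, y₂ ∉ X ∧ G.dist y₁ y₂ ≤ geodesicCycleSup G := by
  classical
  let f : Sym2 V → ZMod 2 := fun e => if ∃ a ∈ X, ∃ k ∈ K, e = s(a, k) then 1 else 0
  have hf1 : ∀ a ∈ X, ∀ k ∈ K, f s(a, k) = 1 := fun a ha k hk => if_pos ⟨a, ha, k, hk, rfl⟩
  have hf0 : ∀ u v, (u ∈ X → v ∉ K) → (v ∈ X → u ∉ K) → f s(u, v) = 0 := by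
    rintro u v huv hvu
    refine if_neg ?_
    rintro ⟨a, ha, k, hk, he⟩
    rcases Sym2.eq_iff.1 he with ⟨rfl, rfl⟩ | ⟨rfl, rfl⟩
    · exact huv ha hk
    · exact hvu ha hk
  have hXK : ∀ v ∈ X, v ∉ K := fun v hv hvK => Set.disjoint_left.1 hKS hvK (hX hv)
  have havoid : ∀ {a b : V} (r : G.Walk a b), (∀ z ∈ r.support, z ∉ X) → r.weight f = 0 :=
    fun r hr => Walk.weight_eq_zero fun u v he =>
      hf0 u v (fun hu => absurd hu (hr u (r.fst_mem_support_of_mem_edges he)))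
        (fun hv => absurd hv (hr v (r.snd_mem_support_of_mem_edges he)))
  let c : G.Walk x₁ x₁ := Walk.cons hxk₁ (p.append (Walk.cons hxk₂.symm (Walk.cons hxl₂
    (q.append (Walk.cons hxl₁.symm Walk.nil)))))
  have hc : c.weight f = 1 := by
    have hk₂ : k₂ ∉ X := fun h => hp k₂ p.end_mem_support (hX h)
    have hl₂ : l₂ ∉ X := fun h => hq l₂ q.start_mem_support (hX h)
    have hl₁' : l₁ ∉ X := fun h => hq l₁ q.end_mem_support (hX h)
    simp only [c, Walk.weight_cons, Walk.weight_append, Walk.weight_nil, hf1 x₁ hx₁ k₁ hk₁,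
      havoid p fun z hz h => hp z hz (hX h), havoid q fun z hz h => hq z hz (hX h),
      hf0 k₂ x₂ (fun h => absurd h hk₂) (fun h => absurd h hx₂'),
      hf0 x₂ l₂ (fun h => absurd h hx₂') (fun h => absurd h hl₂),
      hf0 l₁ x₁ (fun h => absurd h hl₁') (fun _ => hl₁), add_zero]
  obtain ⟨b, o, ho⟩ := Walk.exists_isMinOdd hc
  obtain ⟨y₁, hy₁, hy₁o⟩ : ∃ y ∈ X, y ∈ o.support := by
    by_contra! h
    have := havoid o fun z hz hzX => h z hzX hz
    rw [ho.1] at this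
    exact one_ne_zero this
  obtain ⟨y₂, hy₂, hy₂', hy₂o⟩ : ∃ y ∈ S, y ∉ X ∧ y ∈ o.support := by
    by_contra! h
    have hSX : ∀ v ∈ o.support, v ∈ S → v ∈ X := fun v hv hvS =>
      by_contra fun hvX => h v hvS hvX hv
    have := Walk.weight_eq_add (f := f) (g := fun v => if v ∈ K then 1 else 0) (p := o) ?_
    · rw [ho.1, CharTwo.add_self_eq_zero] at this
      exact one_ne_zero this
    intro u v he
    have huv : G.Adj u v := o.adj_of_mem_edges he
    have hu := hSX u (o.fst_mem_support_of_mem_edges he)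
    have hv := hSX v (o.snd_mem_support_of_mem_edges he)
    by_cases huK : u ∈ K <;> by_cases hvK : v ∈ K
    · rw [hf0 u v (fun h => absurd huK (hXK u h)) (fun h => absurd hvK (hXK v h))]
      simp [huK, hvK, CharTwo.add_self_eq_zero]
    · rw [Sym2.eq_swap, hf1 v (hv ((hK u huK v huv).resolve_left hvK)) u huK]
      simp [huK, hvK]
    · rw [hf1 u (hu ((hK v hvK u huv.symm).resolve_left huK)) v hvK]
      simp [huK, hvK]
    · rw [hf0 u v (fun _ => hvK) (fun _ => huK)]
      simp [huK, hvK]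
  exact ⟨y₁, hy₁, y₂, hy₂, hy₂',
    (Walk.dist_le_length_of_mem_support hy₁o hy₂o).trans ho.length_le_geodesicCycleSup⟩

lemma dist_le_mul_ncard [Finite V] (hG : G.Connected) {n : ℕ} {x y : V} (hx : x ∈ S) (hy : y ∈ S)
    (h : ∀ X ⊆ S, x ∈ X → y ∉ X → ∃ y₁ ∈ X, ∃ y₂ ∈ S, y₂ ∉ X ∧ G.dist y₁ y₂ ≤ n) :
    G.dist x y ≤ n * S.ncard := by
  have := Fintype.ofFinite S
  let H : SimpleGraph S := fromRel fun a b => G.dist a b ≤ n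
  have hwalk : ∀ {a b : S} (p : H.Walk a b), G.dist a b ≤ n * p.length := by
    intro a b p
    induction p with
    | nil => simp
    | @cons a b c hab p ih =>
      have h1 := hG.dist_triangle (u := (a : V)) (v := b) (w := c)
      have h2 : G.dist a b ≤ n := by
        rcases ((fromRel_adj _ _ _).1 hab).2 with h | h
        · exact h
        · rwa [dist_comm]
      rw [Walk.length_cons, mul_add]
      omega
  have hreach : H.Reachable ⟨x, hx⟩ ⟨y, hy⟩ := by
    by_contra hxy
    obtain ⟨_, ⟨y₁, hy₁, rfl⟩, y₂, hy₂, hy₂', hd⟩ :=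
      h (Subtype.val '' {z : S | H.Reachable ⟨x, hx⟩ z}) (by rintro _ ⟨z, -, rfl⟩; exact z.2)
        ⟨⟨x, hx⟩, Reachable.refl _, rfl⟩ (by rintro ⟨z, hz, rfl⟩; exact hxy hz)
    refine hy₂' ⟨⟨y₂, hy₂⟩, hy₁.trans (Adj.reachable ?_), rfl⟩
    rw [fromRel_adj]
    refine ⟨?_, Or.inl hd⟩
    rintro rfl
    exact hy₂' ⟨_, hy₁, rfl⟩
  obtain ⟨p, hp⟩ := hreach.exists_isPath
  have h1 := hp.length_lt
  rw [← Nat.card_eq_fintype_card, Nat.card_coe_set_eq] at h1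
  exact (hwalk p).trans (Nat.mul_le_mul_left n h1.le)

end SimpleGraph

lemma TwoConnected.geodesicCycleSup_pos {V : Type} [Fintype V] {G : SimpleGraph V}
    (hG : TwoConnected G) {x y : V} (hxy : G.Adj x y) : 0 < geodesicCycleSup G := by
  classical
  obtain ⟨z, hzx, hzy⟩ : ∃ z, z ≠ x ∧ z ≠ y := by
    by_contra! h
    have : (Finset.univ : Finset V) ⊆ {x, y} := fun z _ => by
      by_cases hz : z = x
      · simp [hz]
      · simp [h z hz]
    have h1 := (Finset.card_le_card this).trans Finset.card_le_two
    rw [Finset.card_univ] at h1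
    have := hG.2.1
    omega
  have havoid : ∀ a b c : V, a ≠ c → b ≠ c → ∃ p : G.Walk a b, c ∉ p.support := by
    intro a b c ha hb
    obtain ⟨p⟩ := (hG.2.2 c).preconnected ⟨a, ha⟩ ⟨b, hb⟩
    have hp : c ∉ (p.map (Embedding.induce {v | v ≠ c}).toHom).support := by
      rw [Walk.support_map, List.mem_map]
      rintro ⟨w, -, hw⟩
      exact w.2 hw
    exact ⟨_, hp⟩
  obtain ⟨p, hp⟩ := havoid y z x hxy.ne' hzx
  obtain ⟨q, hq⟩ := havoid z x y hzy hxy.ne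
  let f : Sym2 V → ZMod 2 := fun e => if e = s(x, y) then 1 else 0
  have hp0 : p.weight f = 0 := Walk.weight_eq_zero fun u v he => if_neg fun h =>
    hp (p.fst_mem_support_of_mem_edges (h ▸ he))
  have hq0 : q.weight f = 0 := Walk.weight_eq_zero fun u v he => if_neg fun h =>
    hq (q.snd_mem_support_of_mem_edges (h ▸ he))
  have hc : (Walk.cons hxy (p.append q)).weight f = 1 := by
    simp [hp0, hq0, f]
  obtain ⟨b, o, ho⟩ := Walk.exists_isMinOdd hc
  have := ho.isCycle.three_le_length
  have := ho.length_le_geodesicCycleSup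
  omega

namespace TreeDecomp

variable {V ι : Type} {G : SimpleGraph V}

/-- A component of the complement of a bag lives in a single branch of the tree at that bag. -/
lemma exists_attachments_subset_bag (D : TreeDecomp G ι) {t : ι} {u : V} (hu : u ∉ D.bag t) :
    ∃ s, s ≠ t ∧ ∀ w ∈ D.bag t, ∀ k ∈ G.compAvoiding (D.bag t) u, G.Adj w k → w ∈ D.bag s := by
  obtain ⟨p, hp, hpc⟩ := D.isTree.exists_parent t
  set ρ := D.tree.dist t
  choose top htop hpar using fun v => hpc _ (D.bagConn v)
  simp only [Set.mem_ofPred_eq] at htop hpar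
  -- the child of `t` in whose branch `s` lies
  let branch : ι → ι := fun s => p^[ρ s - 1] s
  have hρ0 : ∀ s, ρ s = 0 → s = t := fun s h =>
    (D.isTree.connected.dist_eq_zero_iff.1 h).symm
  have hρt : ρ t = 0 := SimpleGraph.dist_self
  have hbr : ∀ s, s ≠ t → p s ≠ t → branch s = branch (p s) := by
    intro s hs hps
    have h1 := hp s hs
    have h2 : ρ (p s) ≠ 0 := fun h => hps (hρ0 _ h)
    have h3 : ρ s - 1 = (ρ (p s) - 1) + 1 := by omega
    simp only [branch]
    rw [h3, Function.iterate_succ_apply]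
  have hbr' : ∀ s, s ≠ t → p s = t → branch s = s := by
    intro s hs hps
    have h1 := hp s hs
    rw [hps, hρt] at h1
    simp [branch, ← h1]
  have hbrt : ∀ n s, ρ s ≤ n → s ≠ t → branch s ≠ t ∧
      (∀ w ∈ D.bag t, w ∈ D.bag s → w ∈ D.bag (branch s)) ∧
      ∀ v ∉ D.bag t, v ∈ D.bag s → branch s = branch (top v) := by
    intro n
    induction n with
    | zero => exact fun s hs hst => absurd (hρ0 s (by omega)) hst
    | succ n ih =>
      intro s hs hst
      have h1 := hp s hst
      by_cases hps : p s = t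
      · rw [hbr' s hst hps]
        refine ⟨hst, fun _ _ h => h, fun v hv hvs => ?_⟩
        by_cases h : s = top v
        · rw [← h, hbr' s hst hps]
        · exact absurd (hps ▸ (hpar v s hvs h).2) hv
      · rw [hbr s hst hps]
        obtain ⟨ih1, ih2, ih3⟩ := ih (p s) (by omega) hps
        refine ⟨ih1, fun w hwt hws => ih2 w hwt (hpar w s hws ?_).2, fun v hv hvs => ?_⟩
        · rintro rfl
          exact (hpar w t hwt hst.symm).1 rfl
        · by_cases h : s = top v
          · rw [← hbr s hst hps, ← h]
          · exact ih3 v hv (hpar v s hvs h).2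
  have hne : ∀ {v s}, v ∉ D.bag t → v ∈ D.bag s → s ≠ t := by
    rintro v _ hv hvs rfl
    exact hv hvs
  refine ⟨branch (top u), (hbrt _ _ le_rfl (hne hu (htop u))).1, fun w hw k hk hwk => ?_⟩
  have hkt := notMem_of_mem_compAvoiding hk
  have hconst : branch (top k) = branch (top u) := by
    refine compAvoiding_induction (P := fun v => branch (top v) = branch (top u)) rfl ?_ hk
    intro v v' hv hadj hvt hvt'
    obtain ⟨s, hs, hs'⟩ := D.coversEdge hadj
    have h := hbrt _ s le_rfl (hne hvt hs)
    rw [← h.2.2 v' hvt' hs', h.2.2 v hvt hs, hv]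
  obtain ⟨s, hws, hks⟩ := D.coversEdge hwk
  have h := hbrt _ s le_rfl (hne hkt hks)
  rw [← hconst, ← h.2.2 k hkt hks]
  exact h.2.1 w hw hws

/-- Non-adjacent vertices in a common bag of an atomic tree decomposition attach to a common
component of the complement of that bag. -/
lemma IsAtomic.exists_compAvoiding [Fintype V] [Finite ι] {D : TreeDecomp G ι} (hD : D.IsAtomic)
    {t : ι} {x y : V} (hx : x ∈ D.bag t) (hy : y ∈ D.bag t) (hne : x ≠ y) (hxy : ¬ G.Adj x y) :
    ∃ u ∉ D.bag t, (∃ k ∈ G.compAvoiding (D.bag t) u, G.Adj x k) ∧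
      ∃ k ∈ G.compAvoiding (D.bag t) u, G.Adj y k := by
  by_contra! hno
  let Q : Set V := {v | v = x ∨ ∃ u ∉ D.bag t, G.Adj x u ∧ v ∈ G.compAvoiding (D.bag t) u}
  have hQ : ∀ v ∈ Q, v ∈ D.bag t → v = x := by
    rintro v (rfl | ⟨u, -, -, hv⟩) hvt
    · rfl
    · exact absurd hvt (notMem_of_mem_compAvoiding hv)
  have hyQ : y ∉ Q := fun h => hne (hQ y h hy).symm
  have hadj : ∀ u ∈ Q, ∀ v, G.Adj u v → v ∈ Q ∨ v ∈ D.bag t \ {y} := by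
    intro u hu v huv
    by_cases hv : v ∈ D.bag t
    · refine Or.inr ⟨hv, ?_⟩
      rintro rfl
      rcases hu with rfl | ⟨w, hw, hxw, hu⟩
      · exact hxy huv
      · exact hno w hw ⟨w, self_mem_compAvoiding hw, hxw⟩ u hu huv.symm
    · left
      rcases hu with rfl | ⟨w, hw, hxw, hu⟩
      · exact Or.inr ⟨v, hv, huv, self_mem_compAvoiding hv⟩
      · exact Or.inr ⟨w, hw, hxw, mem_compAvoiding_of_adj hu huv hv⟩
  have h := (hD.separation (A := Q ∪ D.bag t \ {y}) (B := Qᶜ) (t := t) (fun v => ?_)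
    (fun u v huv => ?_) ?_ t).1
  · rcases h with h | h
    · exact (h hy).elim hyQ fun h => h.2 rfl
    · exact h hx (Or.inl rfl)
  · by_cases hv : v ∈ Q
    · exact Or.inl (Or.inl hv)
    · exact Or.inr hv
  · by_cases hu : u ∈ Q
    · exact Or.inl ⟨Or.inl hu, hadj u hu v huv⟩
    · by_cases hv : v ∈ Q
      · exact Or.inl ⟨hadj v hv u huv.symm, Or.inl hv⟩
      · exact Or.inr ⟨hu, hv⟩
  · rintro v ⟨hv | hv, hvQ⟩
    · exact absurd hv hvQ
    · exact hv.1

/-- The attachments of a component of the complement of a bag of an atomic tree decomposition all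
attach to a second connected set. -/
lemma IsAtomic.exists_opposite_component [Fintype V] [Finite ι] {D : TreeDecomp G ι}
    (hD : D.IsAtomic) {t : ι} {u : V} (hu : u ∉ D.bag t) {S : Set V}
    (hS : S = {w ∈ D.bag t | ∃ k ∈ G.compAvoiding (D.bag t) u, G.Adj w k}) :
    ∃ w, Disjoint (G.compAvoiding S w) (G.compAvoiding (D.bag t) u) ∧
      ∀ z ∈ S, ∃ l ∈ G.compAvoiding S w, G.Adj z l := by
  have hSt : S ⊆ D.bag t := by rw [hS]; exact Set.sep_subset _ _
  obtain ⟨w, hwt, hwS⟩ : ∃ w ∈ D.bag t, w ∉ S := by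
    by_contra! h
    obtain ⟨s, hst, hs⟩ := D.exists_attachments_subset_bag hu
    refine hst (hD.eq_of_bag_subset fun w hw => ?_).symm
    have := h w hw
    rw [hS] at this
    obtain ⟨-, k, hk, hwk⟩ := this
    exact hs w hw k hk hwk
  refine ⟨w, Set.disjoint_left.2 fun k hk => ?_, fun z hz => ?_⟩
  · refine compAvoiding_induction (P := fun v => v ∉ G.compAvoiding (D.bag t) u)
      (fun h => notMem_of_mem_compAvoiding h hwt) (fun v v' hv hadj hvS _ hv' => ?_) hk
    by_cases hvt : v ∈ D.bag t
    · rw [hS] at hvS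
      exact hvS ⟨hvt, v', hv', hadj⟩
    · exact hv (mem_compAvoiding_of_adj hv' hadj.symm hvt)
  · set L := G.compAvoiding S w
    have hadj : ∀ u ∈ L, ∀ v, G.Adj u v → v ∈ L ∪ {z ∈ S | ∃ l ∈ L, G.Adj z l} := by
      intro u hu v huv
      by_cases hv : v ∈ S
      · exact Or.inr ⟨hv, u, hu, huv.symm⟩
      · exact Or.inl (mem_compAvoiding_of_adj hu huv hv)
    have h := (hD.separation (A := L ∪ {z ∈ S | ∃ l ∈ L, G.Adj z l}) (B := Lᶜ) (t := t)
      (fun v => ?_) (fun u v huv => ?_) ?_ t).1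
    · rcases h with h | h
      · exact (h (hSt hz)).elim (fun h => absurd hz (notMem_of_mem_compAvoiding h)) fun h => h.2
      · exact absurd (self_mem_compAvoiding hwS) (h hwt)
    · by_cases hv : v ∈ L
      · exact Or.inl (Or.inl hv)
      · exact Or.inr hv
    · by_cases hu : u ∈ L
      · exact Or.inl ⟨Or.inl hu, hadj u hu v huv⟩
      · by_cases hv : v ∈ L
        · exact Or.inl ⟨hadj v hv u huv.symm, Or.inl hv⟩
        · exact Or.inr ⟨hu, hv⟩
    · rintro v ⟨hv | hv, hvL⟩
      · exact absurd hv hvL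
      · exact hSt hv.1

/-- Non-adjacent vertices in a common bag of an atomic tree decomposition. -/
lemma IsAtomic.dist_le_of_not_adj [Fintype V] [Finite ι] {D : TreeDecomp G ι} (hD : D.IsAtomic)
    (hG : G.Connected) {t : ι} {x y : V} (hx : x ∈ D.bag t) (hy : y ∈ D.bag t) (hne : x ≠ y)
    (hxy : ¬ G.Adj x y) : G.dist x y ≤ geodesicCycleSup G * (D.bag t).ncard := by
  obtain ⟨u, hu, hxu, hyu⟩ := hD.exists_compAvoiding hx hy hne hxy
  set K := G.compAvoiding (D.bag t) u with hK
  obtain ⟨S, hS⟩ : ∃ S, S = {w ∈ D.bag t | ∃ k ∈ K, G.Adj w k} := ⟨_, rfl⟩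
  have hSt : S ⊆ D.bag t := by rw [hS]; exact Set.sep_subset _ _
  have hSK : ∀ z ∈ S, ∃ k ∈ K, G.Adj z k := fun z hz => by rw [hS] at hz; exact hz.2
  obtain ⟨w, hdisj, hL⟩ := hD.exists_opposite_component hu hS
  have hxS : x ∈ S := by rw [hS]; exact ⟨hx, hxu⟩
  have hyS : y ∈ S := by rw [hS]; exact ⟨hy, hyu⟩
  refine (dist_le_mul_ncard hG hxS hyS fun X hX hxX hyX => ?_).trans
    (Nat.mul_le_mul_left _ (Set.ncard_le_ncard hSt (Set.toFinite _)))
  obtain ⟨k₁, hk₁, hxk⟩ := hSK x hxS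
  obtain ⟨k₂, hk₂, hyk⟩ := hSK y hyS
  obtain ⟨l₁, hl₁, hxl⟩ := hL x hxS
  obtain ⟨l₂, hl₂, hyl⟩ := hL y hyS
  obtain ⟨p, hp⟩ := exists_walk_of_mem_compAvoiding hk₁ hk₂
  obtain ⟨q, hq⟩ := exists_walk_of_mem_compAvoiding hl₂ hl₁
  refine exists_dist_le_geodesicCycleSup (K := K)
    (Set.disjoint_left.2 fun k hk hkS => notMem_of_mem_compAvoiding hk (hSt hkS))
    (fun k hk v hkv => ?_) hX hxX hyX hk₁ (Set.disjoint_left.1 hdisj hl₁) hxk hyk hxl hyl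
    (fun z hz hzS => hp z hz (hSt hzS)) hq
  by_cases hv : v ∈ D.bag t
  · right
    rw [hS]
    exact ⟨hv, k, hk, hkv.symm⟩
  · exact Or.inl (mem_compAvoiding_of_adj hk hkv hv)

end TreeDecomp

/-- Every atomic tree decomposition of a finite two-connected graph `G` has length at
most `ν(G) · (tw(G) + 1)`. -/
theorem atomic_length_le_of_twoConnected {V ι : Type} [Fintype V] [Fintype ι]
    (G : SimpleGraph V) (hG : TwoConnected G)
    (D : TreeDecomp G ι) (hD : D.IsAtomic) :
    D.length ≤ geodesicCycleSup G * (treewidth G + 1) := by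
  refine csSup_le' ?_
  rintro _ ⟨t, x, y, hx, hy, rfl⟩
  by_cases hne : x = y
  · simp [hne]
  by_cases hxy : G.Adj x y
  · rw [dist_eq_one_iff_adj.2 hxy]
    exact Nat.mul_pos (hG.geodesicCycleSup_pos hxy) (Nat.succ_pos _)
  · exact (hD.dist_le_of_not_adj hG.1 hx hy hne hxy).trans
      (Nat.mul_le_mul_left _ (hD.ncard_bag_le t))
end

section
/- Let G be a finite connected graph with a cut vertex x, and let H_1, …, H_ℓ be the connected components of G − x. If for every 1 ≤ i ≤ ℓ the induced subgraph G[V(H_i) ∪ {x}] admits a tree decomposition of length at most L (with distances measured in G[V(H_i) ∪ {x}]), then G admits a tree decomposition of length at most L; in particular tl(G) ≤ max_{1≤i≤ℓ} tl(G[V(H_i) ∪ {x}]). -/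
open SimpleGraph
/-- The graph on `Option (Σ c, ι c)` obtained from the disjoint union of the graphs `T c` by adding
a new vertex `none` adjacent to the chosen vertex `r c` of each `T c`. -/
def SimpleGraph.rootedJoin {C : Type} {ι : C → Type} (T : ∀ c, SimpleGraph (ι c)) (r : ∀ c, ι c) :
    SimpleGraph (Option (Σ c, ι c)) where
  Adj a b :=
    (∃ c, a = none ∧ b = some ⟨c, r c⟩) ∨ (∃ c, a = some ⟨c, r c⟩ ∧ b = none) ∨
      ∃ c i j, (T c).Adj i j ∧ a = some ⟨c, i⟩ ∧ b = some ⟨c, j⟩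
  symm := ⟨by
    rintro a b (⟨c, rfl, rfl⟩ | ⟨c, rfl, rfl⟩ | ⟨c, i, j, h, rfl, rfl⟩)
    · exact Or.inr (Or.inl ⟨c, rfl, rfl⟩)
    · exact Or.inl ⟨c, rfl, rfl⟩
    · exact Or.inr (Or.inr ⟨c, j, i, h.symm, rfl, rfl⟩)⟩
  loopless := ⟨by
    rintro a (⟨c, rfl, h⟩ | ⟨c, rfl, h⟩ | ⟨c, i, j, h, rfl, h'⟩)
    · simp at h
    · simp at h
    · obtain rfl : i = j := by simpa using h'
      exact h.ne rfl⟩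

namespace SimpleGraph

variable {C : Type} {ι : C → Type} {T : ∀ c, SimpleGraph (ι c)} {r : ∀ c, ι c}

theorem rootedJoin_adj_root (c : C) : (rootedJoin T r).Adj (some ⟨c, r c⟩) none :=
  Or.inr (Or.inl ⟨c, rfl, rfl⟩)

/-- The inclusion of `T c` into `rootedJoin T r`. -/
def rootedJoinHom (T : ∀ c, SimpleGraph (ι c)) (r : ∀ c, ι c) (c : C) : T c →g rootedJoin T r where
  toFun i := some ⟨c, i⟩
  map_rel' {i j} h := Or.inr (Or.inr ⟨c, i, j, h, rfl, rfl⟩)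

theorem rootedJoin_connected (hT : ∀ c, (T c).Connected) : (rootedJoin T r).Connected := by
  rw [connected_iff_exists_forall_reachable]
  refine ⟨none, ?_⟩
  rintro (_ | ⟨c, i⟩)
  · exact Reachable.refl _
  · exact ((((hT c).preconnected i (r c)).map (rootedJoinHom T r c)).trans
      (rootedJoin_adj_root c).reachable).symm

theorem rootedJoin_isTree [Finite C] [∀ c, Finite (ι c)] (hT : ∀ c, (T c).IsTree) :
    (rootedJoin T r).IsTree := by
  classical
  have := Fintype.ofFinite C
  have hconn : (rootedJoin T r).Connected := rootedJoin_connected fun c => (hT c).1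
  rw [isTree_iff_connected_and_card]
  refine ⟨hconn, le_antisymm ?_ hconn.card_vert_le_card_edgeSet_add_one⟩
  let f : (Σ c, Option (T c).edgeSet) → (rootedJoin T r).edgeSet := fun
    | ⟨c, none⟩ => ⟨s(some ⟨c, r c⟩, none), rootedJoin_adj_root c⟩
    | ⟨c, some e⟩ => (rootedJoinHom T r c).mapEdgeSet e
  have hf : Function.Surjective f := by
    rintro ⟨e, he⟩
    induction e with | _ a b
    change (rootedJoin T r).Adj a b at he
    obtain ⟨c, ha, hb⟩ | ⟨c, ha, hb⟩ | ⟨c, i, j, h, ha, hb⟩ := id he <;> subst ha hb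
    · exact ⟨⟨c, none⟩, Subtype.ext Sym2.eq_swap⟩
    · exact ⟨⟨c, none⟩, rfl⟩
    · exact ⟨⟨c, some ⟨s(i, j), h⟩⟩, rfl⟩
  have hcard : Nat.card (Σ c, Option (T c).edgeSet) = Nat.card (Σ c, ι c) := by
    rw [Nat.card_sigma, Nat.card_sigma]
    refine Finset.sum_congr rfl fun c _ => ?_
    rw [Finite.card_option, (isTree_iff_connected_and_card.1 (hT c)).2]
  rw [Finite.card_option, ← hcard]
  exact Nat.add_le_add_right (Nat.card_le_card_of_surjective f hf) 1

/-- In a connected graph, a component of `G - x` together with `x` induces a connected subgraph. -/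
theorem Connected.induce_insert_component {V : Type} {G : SimpleGraph V} (hG : G.Connected) (x : V)
    (c : (G.induce {y | y ≠ x}).ConnectedComponent) :
    (G.induce (insert x (Subtype.val '' c.supp))).Connected := by
  have key : ∀ {v w : V} (_ : G.Walk v w) (hv : v ∈ insert x (Subtype.val '' c.supp)), w = x →
      (G.induce (insert x (Subtype.val '' c.supp))).Reachable ⟨x, Set.mem_insert _ _⟩ ⟨v, hv⟩ := by
    intro v w p
    induction p with
    | nil => rintro hv rfl; exact Reachable.refl _
    | @cons v u w hadj p ih =>
      intro hv hw
      by_cases hvx : v = x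
      · subst hvx; exact Reachable.refl _
      have hu : u ∈ insert x (Subtype.val '' c.supp) := by
        by_cases hux : u = x
        · exact Or.inl hux
        obtain rfl | ⟨⟨v, hv'⟩, hvc, rfl⟩ := hv
        · exact absurd rfl hvx
        refine Or.inr ⟨⟨u, hux⟩, ?_, rfl⟩
        exact c.mem_supp_of_adj_mem_supp hvc (by simpa using hadj)
      refine (ih hu hw).trans (Adj.reachable ?_)
      simpa using hadj.symm
  rw [connected_iff_exists_forall_reachable]
  refine ⟨⟨x, Set.mem_insert _ _⟩, ?_⟩
  rintro ⟨v, hv⟩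
  obtain ⟨p⟩ := hG.preconnected v x
  exact key p hv rfl

end SimpleGraph

namespace TreeDecomp

theorem dist_le_length {V ι : Type} [Finite V] {G : SimpleGraph V} (D : TreeDecomp G ι) {i : ι}
    {x y : V} (hx : x ∈ D.bag i) (hy : y ∈ D.bag i) : G.dist x y ≤ D.length := by
  refine le_csSup (Set.Finite.bddAbove ?_) ⟨i, x, y, hx, hy, rfl⟩
  refine (Set.finite_range fun p : V × V => G.dist p.1 p.2).subset ?_
  rintro _ ⟨_, x, y, -, -, rfl⟩
  exact ⟨(x, y), rfl⟩

end TreeDecomp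

theorem exists_treeDecomp_of_components {V : Type} [Finite V] {G : SimpleGraph V}
    (hG : G.Connected) (x : V) (L : ℕ)
    (h : ∀ c : (G.induce {y | y ≠ x}).ConnectedComponent,
      ∃ (ι : Type) (_ : Fintype ι)
        (D : TreeDecomp (G.induce (insert x (Subtype.val '' c.supp))) ι), D.length ≤ L) :
    ∃ (ι : Type) (_ : Fintype ι) (D : TreeDecomp G ι), D.length ≤ L := by
  choose ι hι D hD using h
  let S (c : (G.induce {y | y ≠ x}).ConnectedComponent) : Set V := insert x (Subtype.val '' c.supp)
  have hxS (c) : x ∈ S c := Set.mem_insert _ _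
  choose r hr using fun c => (D c).covers ⟨x, hxS c⟩
  let T := rootedJoin (fun c => (D c).tree) r
  let B : Option (Σ c, ι c) → Set V := fun
    | none => {x}
    | some ⟨c, i⟩ => Subtype.val '' (D c).bag i
  have hB {c i v} (hv : v ∈ S c) : v ∈ B (some ⟨c, i⟩) ↔ ⟨v, hv⟩ ∈ (D c).bag i :=
    ⟨fun ⟨w, hw, hwv⟩ => by subst hwv; exact hw, fun hw => ⟨_, hw, rfl⟩⟩
  have hS {c i v} (hv : v ∈ B (some ⟨c, i⟩)) : v ∈ S c := by
    obtain ⟨w, -, rfl⟩ := hv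
    exact w.2
  have reach {c i j v} (hv : v ∈ S c) (hi : v ∈ B (some ⟨c, i⟩)) (hj : v ∈ B (some ⟨c, j⟩)) :
      (T.induce {a | v ∈ B a}).Reachable ⟨some ⟨c, i⟩, hi⟩ ⟨some ⟨c, j⟩, hj⟩ := by
    let f : (D c).tree.induce {i | ⟨v, hv⟩ ∈ (D c).bag i} →g T.induce {a | v ∈ B a} :=
      { toFun := fun i => ⟨some ⟨c, i.1⟩, (hB hv).2 i.2⟩
        map_rel' := fun {a b} hab =>
          (rootedJoinHom (fun c => (D c).tree) r c).map_adj (v := a.1) (w := b.1) hab }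
    exact (((D c).bagConn ⟨v, hv⟩).preconnected ⟨i, (hB hv).1 hi⟩ ⟨j, (hB hv).1 hj⟩).map f
  have hmem {v} (hv : v ≠ x) : v ∈ S ((G.induce {y | y ≠ x}).connectedComponentMk ⟨v, hv⟩) :=
    Or.inr ⟨⟨v, hv⟩, rfl, rfl⟩
  have huniq {c v} (hv : v ≠ x) (hc : v ∈ S c) :
      (G.induce {y | y ≠ x}).connectedComponentMk ⟨v, hv⟩ = c := by
    obtain rfl | ⟨w, hw, rfl⟩ := hc
    · exact absurd rfl hv
    · exact hw
  have hedge {c v w} (hv : v ∈ S c) (hw : w ∈ S c) (hvw : G.Adj v w) :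
      ∃ a, v ∈ B a ∧ w ∈ B a := by
    obtain ⟨i, h₁, h₂⟩ := (D c).coversEdge (v := ⟨v, hv⟩) (w := ⟨w, hw⟩) hvw
    exact ⟨some ⟨c, i⟩, (hB hv).2 h₁, (hB hw).2 h₂⟩
  have hcov (v) : ∃ a, v ∈ B a := by
    by_cases hv : v = x
    · exact ⟨none, hv⟩
    · obtain ⟨i, hi⟩ := (D _).covers ⟨v, hmem hv⟩
      exact ⟨some ⟨_, i⟩, (hB _).2 hi⟩
  let D' : TreeDecomp G (Option (Σ c, ι c)) :=
    { tree := T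
      isTree := rootedJoin_isTree fun c => (D c).isTree
      bag := B
      covers := hcov
      coversEdge := by
        intro v w hvw
        by_cases hv : v = x
        · subst hv
          exact hedge (hxS _) (hmem hvw.ne') hvw
        by_cases hw : w = x
        · subst hw
          exact hedge (hmem hv) (hxS _) hvw
        refine hedge (hmem hv) ?_ hvw
        refine Or.inr ⟨⟨w, hw⟩, ?_, rfl⟩
        have hadj : (G.induce {y | y ≠ x}).Adj ⟨w, hw⟩ ⟨v, hv⟩ := hvw.symm
        exact ConnectedComponent.sound hadj.reachable
      bagConn := by
        intro v
        rw [connected_iff_exists_forall_reachable]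
        by_cases hv : v = x
        · subst hv
          refine ⟨⟨none, rfl⟩, ?_⟩
          rintro ⟨_ | ⟨c, i⟩, hi⟩
          · exact Reachable.refl _
          · have hrc : v ∈ B (some ⟨c, r c⟩) := (hB (hxS c)).2 (hr c)
            have hadj : (T.induce {a | v ∈ B a}).Adj ⟨some ⟨c, r c⟩, hrc⟩ ⟨none, rfl⟩ :=
              rootedJoin_adj_root c
            exact ((reach (hxS c) hi hrc).trans hadj.reachable).symm
        · obtain ⟨_ | ⟨c, i⟩, hi⟩ := hcov v
          · exact absurd hi hv
          refine ⟨⟨some ⟨c, i⟩, hi⟩, ?_⟩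
          rintro ⟨_ | ⟨c', j⟩, hj⟩
          · exact absurd hj hv
          · obtain rfl := (huniq hv (hS hi)).symm.trans (huniq hv (hS hj))
            exact reach (hS hi) hi hj }
  refine ⟨_, Fintype.ofFinite _, D', csSup_le' ?_⟩
  rintro _ ⟨_ | ⟨c, i⟩, v, w, hv, hw, rfl⟩
  · obtain rfl : v = x := hv
    obtain rfl : w = v := hw
    simp
  · obtain ⟨v, hv, rfl⟩ := hv
    obtain ⟨w, hw, rfl⟩ := hw
    refine le_trans ?_ (((D c).dist_le_length hv hw).trans (hD c))
    obtain ⟨p, hp⟩ := (hG.induce_insert_component x c).exists_walk_length_eq_dist v w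
    rw [← hp, ← p.length_map (Embedding.induce _).toHom]
    exact dist_le _

/-- Decomposing over a cut vertex: if every block `G[V(H_i) ∪ {x}]` (for `H_i` the
connected components of `G - x`) has a tree decomposition of length at most `L`, then so
does `G`; in particular `tl(G) ≤ max_i tl(G[V(H_i) ∪ {x}])`. -/
theorem treelength_le_of_cutVertex {V : Type} [Fintype V] (G : SimpleGraph V)
    (hG : G.Connected) (x : V)
    (hx : ¬ (G.induce {y | y ≠ x}).Connected) (L : ℕ)
    (h : ∀ c : (G.induce {y | y ≠ x}).ConnectedComponent,
      ∃ (ι : Type) (_ : Fintype ι)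
        (D : TreeDecomp (G.induce (insert x (Subtype.val '' c.supp))) ι),
        D.length ≤ L) :
    (∃ (ι : Type) (_ : Fintype ι) (D : TreeDecomp G ι), D.length ≤ L) ∧
    treelength G ≤ ⨆ c : (G.induce {y | y ≠ x}).ConnectedComponent,
      treelength (G.induce (insert x (Subtype.val '' c.supp))) := by
  refine ⟨exists_treeDecomp_of_components hG x L h, ?_⟩
  obtain ⟨ι, hι, D, hD⟩ := exists_treeDecomp_of_components hG x
    (⨆ c : (G.induce {y | y ≠ x}).ConnectedComponent,
      treelength (G.induce (insert x (Subtype.val '' c.supp)))) fun c => by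
    obtain ⟨ι, hι, D, -⟩ := h c
    obtain ⟨ι', hι', D', hD'⟩ := Nat.sInf_mem (s := {l | ∃ (ι : Type) (_ : Fintype ι)
      (D : TreeDecomp (G.induce (insert x (Subtype.val '' c.supp))) ι), D.length = l})
      ⟨_, ι, hι, D, rfl⟩
    exact ⟨ι', hι', D', hD'.le.trans (le_ciSup (f := fun c :
      (G.induce {y | y ≠ x}).ConnectedComponent =>
        treelength (G.induce (insert x (Subtype.val '' c.supp))))
      (Set.finite_range _).bddAbove c)⟩
  exact le_trans (Nat.sInf_le ⟨ι, hι, D, rfl⟩) hD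
end

section
/- Let ({X_i}, T) be an atomic tree decomposition of a finite connected graph G = (V,E). Then for any two distinct vertices x, y that occur together in some bag X_t, either (x,y) ∈ E or there exists a neighbor s of t in T such that {x, y} ⊆ X_s ∩ X_t. -/
open SimpleGraph
namespace SimpleGraph

/-- A graph fibred over a connected graph is connected as soon as its fibres are connected and
every edge of the base lifts. -/
theorem Connected.of_fibers {α β : Type*} {H : SimpleGraph α} {K : SimpleGraph β}
    (hH : H.Connected) [Nonempty β] (r : β → α)
    (hfib : ∀ b b', r b = r b' → K.Reachable b b')
    (hlift : ∀ a a', H.Adj a a' → ∃ b b', r b = a ∧ r b' = a' ∧ K.Reachable b b') :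
    K.Connected := by
  have key : ∀ {a a' : α}, H.Walk a a' → ∀ b b', r b = a → r b' = a' → K.Reachable b b' := by
    intro a a' p
    induction p with
    | nil => exact fun b b' hb hb' => hfib b b' (hb.trans hb'.symm)
    | cons h p ih =>
      intro b b' hb hb'
      obtain ⟨c, d, hc, hd, hcd⟩ := hlift _ _ h
      exact ((hfib b c (hb.trans hc.symm)).trans hcd).trans (ih d b' hd hb')
  have hpre : K.Preconnected := fun b b' =>
    (hH.preconnected (r b) (r b')).elim fun p => key p b b' rfl rfl
  exact ⟨hpre⟩

/-- Split the node `t` of `T` into the adjacent nodes `some t` and `none`, attaching to `none`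
the neighbours of `t` that lie in `S` and leaving the others at `some t`. -/
def splitNode {ι : Type*} (T : SimpleGraph ι) (t : ι) (S : Set ι) : SimpleGraph (Option ι) where
  Adj
    | none, none => False
    | none, some a => a = t ∨ (T.Adj t a ∧ a ∈ S)
    | some a, none => a = t ∨ (T.Adj t a ∧ a ∈ S)
    | some a, some b => T.Adj a b ∧ ¬ (a = t ∧ b ∈ S) ∧ ¬ (b = t ∧ a ∈ S)
  symm := ⟨by
    rintro (_ | a) (_ | b) h
    · exact h
    · exact h
    · exact h
    · exact ⟨h.1.symm, h.2.2, h.2.1⟩⟩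
  loopless := ⟨by
    rintro (_ | a) h
    · exact h
    · exact T.loopless.irrefl a h.1⟩

section splitNode

variable {ι : Type*} {T : SimpleGraph ι} {t : ι} {S : Set ι}

@[simp] theorem splitNode_adj_none_none : ¬ (T.splitNode t S).Adj none none := id

@[simp] theorem splitNode_adj_none_some {a : ι} :
    (T.splitNode t S).Adj none (some a) ↔ a = t ∨ (T.Adj t a ∧ a ∈ S) := Iff.rfl

@[simp] theorem splitNode_adj_some_none {a : ι} :
    (T.splitNode t S).Adj (some a) none ↔ a = t ∨ (T.Adj t a ∧ a ∈ S) := Iff.rfl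

@[simp] theorem splitNode_adj_some_some {a b : ι} :
    (T.splitNode t S).Adj (some a) (some b) ↔
      T.Adj a b ∧ ¬ (a = t ∧ b ∈ S) ∧ ¬ (b = t ∧ a ∈ S) := Iff.rfl

theorem splitNode_adj_of_getD_eq {b b' : Option ι} (h : b.getD t = b'.getD t) (hne : b ≠ b') :
    (T.splitNode t S).Adj b b' := by
  rcases b with _ | a <;> rcases b' with _ | a' <;> simp_all

theorem exists_splitNode_adj {a a' : ι} (h : T.Adj a a') :
    ∃ b b', b.getD t = a ∧ b'.getD t = a' ∧ (T.splitNode t S).Adj b b' := by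
  by_cases h1 : a = t ∧ a' ∈ S
  · exact ⟨none, some a', h1.1.symm, rfl, Or.inr ⟨h1.1 ▸ h, h1.2⟩⟩
  by_cases h2 : a' = t ∧ a ∈ S
  · exact ⟨some a, none, rfl, h2.1.symm, Or.inr ⟨h2.1 ▸ h.symm, h2.2⟩⟩
  exact ⟨some a, some a', rfl, rfl, h, h1, h2⟩

theorem Connected.splitNode (hT : T.Connected) : (T.splitNode t S).Connected := by
  refine hT.of_fibers (fun b : Option ι => b.getD t) (fun b b' h => ?_) (fun a a' h => ?_)
  · by_cases hne : b = b'
    · exact hne ▸ Reachable.rfl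
    · exact (splitNode_adj_of_getD_eq h hne).reachable
  · obtain ⟨b, b', hb, hb', hadj⟩ := exists_splitNode_adj (t := t) (S := S) h
    exact ⟨b, b', hb, hb', hadj.reachable⟩

theorem splitNode_induce_connected {P : Set ι} {Q : Set (Option ι)}
    (hP : (T.induce P).Connected) (hne : Q.Nonempty) (hQ : ∀ b ∈ Q, b.getD t ∈ P)
    (hlift : ∀ a ∈ P, ∀ a' ∈ P, T.Adj a a' → ∃ b ∈ Q, ∃ b' ∈ Q,
      b.getD t = a ∧ b'.getD t = a' ∧ (T.splitNode t S).Adj b b') :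
    ((T.splitNode t S).induce Q).Connected := by
  have := hne.to_subtype
  refine hP.of_fibers (fun b : Q => (⟨b.1.getD t, hQ b.1 b.2⟩ : P)) (fun b b' h => ?_) ?_
  · by_cases hbb : b = b'
    · exact hbb ▸ Reachable.rfl
    · exact Adj.reachable (G := (T.splitNode t S).induce Q) (splitNode_adj_of_getD_eq
        (congrArg Subtype.val h) fun h' => hbb (Subtype.ext h'))
  · rintro ⟨a, ha⟩ ⟨a', ha'⟩ h
    obtain ⟨b, hb, b', hb', e, e', hadj⟩ := hlift a ha a' ha' h
    exact ⟨⟨b, hb⟩, ⟨b', hb'⟩, Subtype.ext e, Subtype.ext e',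
      Adj.reachable (G := (T.splitNode t S).induce Q) hadj⟩

theorem ncard_edgeSet_splitNode_le [Finite ι] :
    (T.splitNode t S).edgeSet.ncard ≤ T.edgeSet.ncard + 1 := by
  have h : ((T.splitNode t S).edgeSet \ {s(none, some t)}).ncard ≤ T.edgeSet.ncard := by
    refine Set.ncard_le_ncard_of_injOn (Sym2.map fun b => b.getD t) ?_ ?_ (Set.toFinite _)
    · intro e he
      induction e with | _ b b'
      rcases b with _ | a <;> rcases b' with _ | a' <;> simp_all [adj_comm]
      · grind
      · grind
    · intro e he e' he' hee
      induction e with | _ b b'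
      induction e' with | _ c c'
      have hs := fun u v => T.adj_comm u v
      have hl := fun u => T.loopless.irrefl u
      rcases b with _ | a <;> rcases b' with _ | a' <;> rcases c with _ | d <;>
        rcases c' with _ | d' <;> simp_all <;> grind
  have := Set.ncard_le_ncard_sdiff_add_ncard (T.splitNode t S).edgeSet {s(none, some t)}
  rw [Set.ncard_singleton] at this
  omega

theorem IsTree.splitNode [Finite ι] (hT : T.IsTree) : (T.splitNode t S).IsTree := by
  rw [isTree_iff_connected_and_card] at hT ⊢
  refine ⟨hT.1.splitNode, le_antisymm ?_ ?_⟩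
  · have h := ncard_edgeSet_splitNode_le (T := T) (t := t) (S := S)
    have h' := hT.2
    rw [← Nat.card_coe_set_eq, ← Nat.card_coe_set_eq] at h
    rw [Finite.card_option]
    omega
  · exact hT.1.splitNode.card_vert_le_card_edgeSet_add_one

end splitNode

end SimpleGraph

namespace TreeDecomp

variable {V ι : Type} {G : SimpleGraph V}

/-- Split the node `t` into two nodes, one whose bag misses `y` and one whose bag misses `x`. -/
def split [Finite ι] (D : TreeDecomp G ι) (t : ι) (x y : V) (hxy : x ≠ y)
    (hx : x ∈ D.bag t) (hy : y ∈ D.bag t) (hadj : ¬ G.Adj x y)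
    (hs : ∀ s, D.tree.Adj t s → x ∈ D.bag s → y ∉ D.bag s) : TreeDecomp G (Option ι) where
  tree := D.tree.splitNode t {s | y ∈ D.bag s}
  isTree := D.isTree.splitNode
  bag
    | none => D.bag t \ {x}
    | some i => D.bag i \ {z | i = t ∧ z = y}
  covers v := by
    obtain ⟨i, hi⟩ := D.covers v
    by_cases h : i = t ∧ v = y
    · exact ⟨none, h.1 ▸ hi, fun h' => hxy (h'.symm.trans h.2)⟩
    · exact ⟨some i, hi, h⟩
  coversEdge v w hvw := by
    obtain ⟨i, hv, hw⟩ := D.coversEdge hvw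
    by_cases h : i = t ∧ (v = y ∨ w = y)
    · obtain ⟨rfl, h⟩ := h
      refine ⟨none, ⟨hv, ?_⟩, ⟨hw, ?_⟩⟩
      · rintro rfl
        rcases h with h | rfl
        · exact hxy h
        · exact hadj hvw
      · rintro rfl
        rcases h with rfl | h
        · exact hadj hvw.symm
        · exact hxy h
    · exact ⟨some i, ⟨hv, fun h' => h ⟨h'.1, Or.inl h'.2⟩⟩, ⟨hw, fun h' => h ⟨h'.1, Or.inr h'.2⟩⟩⟩
  bagConn v := by
    refine splitNode_induce_connected (D.bagConn v) ?_ ?_ ?_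
    · by_cases h : v = y
      · exact ⟨none, h ▸ hy, fun h' => hxy (h'.symm.trans h)⟩
      · obtain ⟨i, hi⟩ := D.covers v
        exact ⟨some i, hi, fun h' => h h'.2⟩
    · rintro (_ | i) hb
      · exact hb.1
      · exact hb.1
    · intro a ha a' ha' h
      by_cases h1 : a = t ∧ y ∈ D.bag a'
      · obtain ⟨rfl, h1⟩ := h1
        refine ⟨none, ⟨ha, ?_⟩, some a', ⟨ha', ?_⟩, rfl, rfl, Or.inr ⟨h, h1⟩⟩
        · rintro rfl
          exact hs a' h ha' h1
        · rintro ⟨rfl, -⟩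
          exact h.ne rfl
      by_cases h2 : a' = t ∧ y ∈ D.bag a
      · obtain ⟨rfl, h2⟩ := h2
        refine ⟨some a, ⟨ha, ?_⟩, none, ⟨ha', ?_⟩, rfl, rfl, Or.inr ⟨h.symm, h2⟩⟩
        · rintro ⟨rfl, -⟩
          exact h.ne rfl
        · rintro rfl
          exact hs a h.symm ha h2
      refine ⟨some a, ⟨ha, ?_⟩, some a', ⟨ha', ?_⟩, rfl, rfl, h, h1, h2⟩
      · rintro ⟨rfl, rfl⟩
        exact h1 ⟨rfl, ha'⟩
      · rintro ⟨rfl, rfl⟩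
        exact h2 ⟨rfl, ha⟩

end TreeDecomp

theorem not_finLexLE_of_lt {m : ℕ} {f g : Fin m → ℕ} (k : Fin m) (heq : ∀ j < k, g j = f j)
    (hlt : g k < f k) : ¬ FinLexLE f g := by
  rintro (rfl | ⟨l, hl, hfl⟩)
  · exact hlt.false
  · rcases lt_trichotomy k l with h | rfl | h
    · exact hlt.ne (hl k h).symm
    · exact hlt.asymm hfl
    · exact hfl.ne (heq l h).symm

/-- In an atomic tree decomposition of a finite connected graph, two distinct vertices in
a common bag `X_t` are either adjacent, or both lie in `X_s ∩ X_t` for some neighbour `s`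
of `t` in the tree. -/
theorem atomic_adj_or_commonNeighborBag {V ι : Type} [Fintype V] [Fintype ι]
    (G : SimpleGraph V) (hG : G.Connected)
    (D : TreeDecomp G ι) (hD : D.IsAtomic) (t : ι) (x y : V) (hxy : x ≠ y)
    (hx : x ∈ D.bag t) (hy : y ∈ D.bag t) :
    G.Adj x y ∨ ∃ s, D.tree.Adj s t ∧ x ∈ D.bag s ∩ D.bag t ∧ y ∈ D.bag s ∩ D.bag t := by
  by_contra hcon
  push Not at hcon
  obtain ⟨hadj, hno⟩ := hcon
  have hs : ∀ s, D.tree.Adj t s → x ∈ D.bag s → y ∉ D.bag s := fun s hts hxs hys =>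
    hno s hts.symm ⟨hxs, hx⟩ ⟨hys, hy⟩
  set D' := D.split t x y hxy hx hy hadj hs
  have hnone : (D'.bag none).ncard < (D.bag t).ncard :=
    Set.ncard_sdiff_singleton_lt_of_mem hx (Set.toFinite _)
  have hsome : (D'.bag (some t)).ncard < (D.bag t).ncard :=
    Set.ncard_lt_ncard ⟨Set.sdiff_subset, fun h => (h hy).2 ⟨rfl, rfl⟩⟩ (Set.toFinite _)
  have hother : ∀ i, i ≠ t → D'.bag (some i) = D.bag i := fun i hi =>
    sdiff_eq_left.2 (Set.disjoint_left.2 fun _ _ h => hi h.1)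
  have hset : ∀ m, (D.bag t).ncard ≤ m →
      {j | (D'.bag j).ncard = m} = some '' ({i | (D.bag i).ncard = m} \ {t}) := by
    intro m hm
    ext (_ | i)
    · simp only [Set.mem_ofPred_eq, Set.mem_image, reduceCtorEq, and_false, exists_false, iff_false]
      omega
    · rw [(Option.some_injective ι).mem_set_image]
      by_cases hi : i = t
      · subst hi
        simp only [Set.mem_ofPred_eq, Set.mem_sdiff, Set.mem_singleton_iff, not_true_eq_false,
          and_false, iff_false]
        omega
      · simp [hother i hi, hi]
  have hle : (D.bag t).ncard ≤ Fintype.card V := by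
    rw [← Nat.card_eq_fintype_card]
    exact Set.ncard_le_card _
  refine not_finLexLE_of_lt ⟨Fintype.card V - (D.bag t).ncard, by omega⟩ (fun j hj => ?_) ?_
    (hD (Option ι) inferInstance D')
  · have hj' : (j : ℕ) < Fintype.card V - (D.bag t).ncard := hj
    unfold TreeDecomp.fatness
    rw [hset _ (by omega), Set.ncard_image_of_injective _ (Option.some_injective ι),
      Set.sdiff_singleton_eq_self]
    simp only [Set.mem_ofPred_eq]
    omega
  · unfold TreeDecomp.fatness
    have hk : Fintype.card V - (Fintype.card V - (D.bag t).ncard) = (D.bag t).ncard := by omega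
    simp only [hk]
    rw [hset _ le_rfl, Set.ncard_image_of_injective _ (Option.some_injective ι)]
    exact Set.ncard_sdiff_singleton_lt_of_mem rfl (Set.toFinite _)
end

section
/- Every finite connected graph G on n vertices with Gromov hyperbolicity δ satisfies tl(G) ≤ 17 + 12δ + 8δ log₂ n. -/
open SimpleGraph
/-- The graph joining every index other than `r` to its image under the parent map `f`. -/
def parentGraph {ι : Type} (f : ι → ι) (r : ι) : SimpleGraph ι :=
  SimpleGraph.fromRel fun i j => i ≠ r ∧ f i = j

theorem parentGraph_isTree {ι : Type} [Finite ι] (f : ι → ι) (r : ι) (level : ι → ℕ)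
    (hlevel : ∀ i, i ≠ r → level (f i) < level i) : (parentGraph f r).IsTree := by
  have hadj : ∀ i, i ≠ r → (parentGraph f r).Adj i (f i) := fun i hi =>
    ⟨fun h => (hlevel i hi).ne (by rw [← h]), Or.inl ⟨hi, rfl⟩⟩
  have hreach : ∀ n i, level i = n → (parentGraph f r).Reachable r i := by
    intro n
    induction n using Nat.strong_induction_on with
    | _ n ih =>
      intro i hn
      by_cases hi : i = r
      · rw [hi]
      · exact (ih _ (hn ▸ hlevel i hi) _ rfl).trans (hadj i hi).symm.reachable
  have hconn : (parentGraph f r).Connected :=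
    SimpleGraph.connected_iff_exists_forall_reachable _ |>.2 ⟨r, fun i => hreach _ i rfl⟩
  refine SimpleGraph.isTree_iff_connected_and_card.2 ⟨hconn, le_antisymm ?_
    hconn.card_vert_le_card_edgeSet_add_one⟩
  have hsub : (parentGraph f r).edgeSet ⊆ (fun i => s(i, f i)) '' {r}ᶜ := by
    intro e
    induction e with
    | _ a b =>
      rintro ⟨-, ⟨h, hf : f a = b⟩ | ⟨h, hf : f b = a⟩⟩
      · exact ⟨a, h, hf ▸ rfl⟩
      · exact ⟨b, h, hf ▸ Sym2.eq_swap⟩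
  have h1 : (parentGraph f r).edgeSet.ncard ≤ ({r}ᶜ : Set ι).ncard :=
    (Set.ncard_le_ncard hsub (Set.toFinite _)).trans (Set.ncard_image_le (Set.toFinite _))
  have h2 := Set.ncard_add_ncard_compl ({r} : Set ι)
  rw [Set.ncard_singleton] at h2
  rw [Nat.card_coe_set_eq]
  omega

section FourPoint

variable {V : Type} {G : SimpleGraph V}

theorem hyperbolicity_nonneg : 0 ≤ hyperbolicity G :=
  Real.sInf_nonneg fun _ h => h.1

theorem four_point_hyperbolicity [Fintype V] (w x y z : V) :
    (G.dist w x : ℝ) + (G.dist y z : ℝ) ≤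
      max ((G.dist w y : ℝ) + (G.dist x z : ℝ)) ((G.dist w z : ℝ) + (G.dist x y : ℝ)) +
        2 * hyperbolicity G := by
  have hne : {δ : ℝ | 0 ≤ δ ∧ ∀ w x y z : V,
    (G.dist w x : ℝ) + (G.dist y z : ℝ) ≤
      max ((G.dist w y : ℝ) + (G.dist x z : ℝ)) ((G.dist w z : ℝ) + (G.dist x y : ℝ)) +
        2 * δ}.Nonempty := by
    obtain ⟨M, hM⟩ := (Set.finite_range fun p : V × V => G.dist p.1 p.2).bddAbove
    have hM' : ∀ a b, (G.dist a b : ℝ) ≤ M := fun a b => by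
      exact_mod_cast hM ⟨(a, b), rfl⟩
    refine ⟨M, Nat.cast_nonneg _, fun w x y z => ?_⟩
    have h0 : (0 : ℝ) ≤ max ((G.dist w y : ℝ) + (G.dist x z : ℝ))
      ((G.dist w z : ℝ) + (G.dist x y : ℝ)) := le_max_of_le_left (by positivity)
    linarith [hM' w x, hM' y z]
  have := le_csInf hne (a := ((G.dist w x : ℝ) + (G.dist y z : ℝ) -
      max ((G.dist w y : ℝ) + (G.dist x z : ℝ)) ((G.dist w z : ℝ) + (G.dist x y : ℝ))) / 2)
    fun δ hδ => by linarith [hδ.2 w x y z]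
  change _ ≤ hyperbolicity G at this
  linarith

/-- Along a walk of at most `2 ^ j` edges staying at distance at least `k` from `r`, the Gromov
product of the endpoints based at `r` drops by at most `δ * j` below `k - 1 / 2`. -/
theorem gromovProduct_ge_of_walk [Fintype V] (r : V) (k j : ℕ) {u v : V} (p : G.Walk u v)
    (hlen : p.length ≤ 2 ^ j) (hp : ∀ x ∈ p.support, k ≤ G.dist r x) :
    (2 * k - 1 - 2 * hyperbolicity G * j : ℝ) ≤ G.dist r u + G.dist r v - G.dist u v := by
  induction j generalizing u v with
  | zero =>
    have h1 : (G.dist u v : ℝ) ≤ 1 := by exact_mod_cast (SimpleGraph.dist_le p).trans hlen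
    have h2 : (k : ℝ) ≤ G.dist r u := by exact_mod_cast hp u p.start_mem_support
    have h3 : (k : ℝ) ≤ G.dist r v := by exact_mod_cast hp v p.end_mem_support
    push_cast
    linarith
  | succ j ih =>
    have h1 := ih (p.take (2 ^ j)) (by rw [SimpleGraph.Walk.take_length]; exact min_le_left _ _)
      fun x hx => hp x ((p.isSubwalk_take _).support_subset hx)
    have h2 := ih (p.drop (2 ^ j))
      (by rw [SimpleGraph.Walk.drop_length]; rw [pow_succ] at hlen; omega)
      fun x hx => hp x ((p.isSubwalk_drop _).support_subset hx)
    have h3 := four_point_hyperbolicity (G := G) r (p.getVert (2 ^ j)) u v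
    rw [G.dist_comm (u := p.getVert (2 ^ j)) (v := u)] at h3
    push_cast
    rcases le_total ((G.dist r u : ℝ) + (G.dist (p.getVert (2 ^ j)) v : ℝ))
      ((G.dist r v : ℝ) + (G.dist u (p.getVert (2 ^ j)) : ℝ)) with h | h
    · rw [max_eq_right h] at h3
      linarith
    · rw [max_eq_left h] at h3
      linarith

end FourPoint

section Layering

variable {V : Type} (G : SimpleGraph V) (r : V)

/-- Two vertices in the same layer around `r` are related when they are joined by a walk that does
not come closer to `r`. -/
def layerSetoid : Setoid V where
  r u v := G.dist r u = G.dist r v ∧ ∃ p : G.Walk u v, ∀ x ∈ p.support, G.dist r u ≤ G.dist r x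
  iseqv :=
    { refl := fun u => ⟨rfl, SimpleGraph.Walk.nil, by simp⟩
      symm := by
        rintro u v ⟨h, p, hp⟩
        exact ⟨h.symm, p.reverse, fun x hx => h ▸ hp x (by simpa using hx)⟩
      trans := by
        rintro u v w ⟨h, p, hp⟩ ⟨h', q, hq⟩
        refine ⟨h.trans h', p.append q, fun x hx => ?_⟩
        rcases SimpleGraph.Walk.mem_support_append_iff _ _ |>.1 hx with hx | hx
        · exact hp x hx
        · exact h ▸ hq x hx }

/-- The clusters of the layering partition of `G` around `r`. -/
abbrev Cluster : Type := Quotient (layerSetoid G r)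

variable {G r}

/-- The cluster containing a given vertex. -/
def toCluster (v : V) : Cluster G r := Quotient.mk (layerSetoid G r) v

theorem toCluster_out (i : Cluster G r) : toCluster i.out = i := Quotient.out_eq i

theorem toCluster_eq_iff {u v : V} : (toCluster u : Cluster G r) = toCluster v ↔
    G.dist r u = G.dist r v ∧ ∃ p : G.Walk u v, ∀ x ∈ p.support, G.dist r u ≤ G.dist r x :=
  Quotient.eq (r := layerSetoid G r)

theorem exists_adj_dist_add_one_eq (hG : G.Connected) {v : V} (hv : v ≠ r) :
    ∃ w, G.Adj v w ∧ G.dist r w + 1 = G.dist r v := by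
  obtain ⟨p, hp⟩ := hG.exists_walk_length_eq_dist v r
  cases p with
  | nil => exact absurd rfl hv
  | @cons _ w _ h q =>
    refine ⟨w, h, ?_⟩
    have h1 := SimpleGraph.dist_le q
    have h2 := hG.dist_triangle (u := v) (v := w) (w := r)
    rw [SimpleGraph.dist_eq_one_iff_adj.2 h] at h2
    rw [SimpleGraph.Walk.length_cons] at hp
    rw [G.dist_comm (u := r), G.dist_comm (u := r)]
    omega

theorem toCluster_eq_of_adj_lower {u v u' v' : V} (h : (toCluster u : Cluster G r) = toCluster v)
    (hu : G.Adj u u') (hu' : G.dist r u' + 1 = G.dist r u)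
    (hv : G.Adj v v') (hv' : G.dist r v' + 1 = G.dist r v) :
    (toCluster u' : Cluster G r) = toCluster v' := by
  obtain ⟨hd, p, hp⟩ := toCluster_eq_iff.1 h
  refine toCluster_eq_iff.2 ⟨by omega, .cons hu.symm (p.concat hv), fun x hx => ?_⟩
  rw [SimpleGraph.Walk.support_cons, SimpleGraph.Walk.support_concat] at hx
  simp only [List.mem_cons, List.mem_append, List.not_mem_nil,
    or_false] at hx
  rcases hx with rfl | hx | rfl
  · rfl
  · have := hp x hx
    omega
  · omega

open Classical in
/-- The cluster of the neighbours, one layer closer to `r`, of the vertices of a cluster. -/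
noncomputable def clusterParent (i : Cluster G r) : Cluster G r :=
  if h : ∃ w, G.Adj i.out w ∧ G.dist r w + 1 = G.dist r i.out then toCluster h.choose else i

theorem clusterParent_toCluster {v w : V} (h : G.Adj v w) (hd : G.dist r w + 1 = G.dist r v)
    (hG : G.Connected) : clusterParent (toCluster v : Cluster G r) = toCluster w := by
  have hout := toCluster_out (toCluster v : Cluster G r)
  have hne : (toCluster v : Cluster G r).out ≠ r := by
    intro h0
    have := (toCluster_eq_iff.1 hout).1
    rw [h0, SimpleGraph.dist_self] at this
    omega
  have hex := exists_adj_dist_add_one_eq hG hne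
  rw [clusterParent, dif_pos hex]
  exact toCluster_eq_of_adj_lower hout hex.choose_spec.1 hex.choose_spec.2 h hd

theorem toCluster_ne_root {v w : V} (hd : G.dist r w + 1 = G.dist r v) :
    (toCluster v : Cluster G r) ≠ toCluster r := by
  intro h
  have := (toCluster_eq_iff.1 h).1
  rw [SimpleGraph.dist_self] at this
  omega

theorem dist_out_clusterParent_lt (hG : G.Connected) (i : Cluster G r) (hi : i ≠ toCluster r) :
    G.dist r (clusterParent i).out < G.dist r i.out := by
  have hne : i.out ≠ r := fun h => hi ((toCluster_out i).symm.trans (congrArg toCluster h))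
  obtain ⟨w, hw, hd⟩ := exists_adj_dist_add_one_eq hG hne
  have h1 := clusterParent_toCluster hw hd hG
  rw [toCluster_out] at h1
  have h2 := (toCluster_eq_iff.1 (toCluster_out (toCluster w : Cluster G r))).1
  rw [h1]
  omega

/-- The tree decomposition of a finite connected graph along its layering partition: each bag is a
cluster together with its neighbours one layer closer to `r`. -/
noncomputable def layeringTreeDecomp [Finite V] (hG : G.Connected) (r : V) :
    TreeDecomp G (Cluster G r) where
  tree := parentGraph clusterParent (toCluster r)
  isTree := parentGraph_isTree _ _ (fun i => G.dist r i.out) (dist_out_clusterParent_lt hG)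
  bag i := {v | toCluster v = i ∨ ∃ u, toCluster u = i ∧ G.Adj u v ∧ G.dist r v + 1 = G.dist r u}
  covers v := ⟨toCluster v, Or.inl rfl⟩
  coversEdge v w h := by
    have h1 := hG.dist_triangle (u := r) (v := v) (w := w)
    have h2 := hG.dist_triangle (u := r) (v := w) (w := v)
    rw [SimpleGraph.dist_eq_one_iff_adj.2 h] at h1
    rw [SimpleGraph.dist_eq_one_iff_adj.2 h.symm] at h2
    obtain hd | hd | hd : G.dist r v + 1 = G.dist r w ∨ G.dist r w + 1 = G.dist r v ∨
        G.dist r v = G.dist r w := by omega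
    · exact ⟨toCluster w, Or.inr ⟨w, rfl, h.symm, hd⟩, Or.inl rfl⟩
    · exact ⟨toCluster v, Or.inl rfl, Or.inr ⟨v, rfl, h, hd⟩⟩
    · refine ⟨toCluster v, Or.inl rfl, Or.inl (toCluster_eq_iff.2 ⟨hd.symm, h.symm.toWalk, ?_⟩)⟩
      intro x hx
      simp only [SimpleGraph.Adj.toWalk, SimpleGraph.Walk.support_cons,
        SimpleGraph.Walk.support_nil, List.mem_cons, List.not_mem_nil, or_false] at hx
      rcases hx with rfl | rfl <;> omega
  bagConn v := by
    refine SimpleGraph.connected_iff_exists_forall_reachable _ |>.2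
      ⟨⟨toCluster v, Or.inl rfl⟩, ?_⟩
    rintro ⟨i, rfl | ⟨u, rfl, hadj, hd⟩⟩
    · rfl
    · refine SimpleGraph.Adj.reachable ?_
      have hpar := clusterParent_toCluster hadj hd hG
      refine ⟨fun h => ?_, Or.inr ⟨toCluster_ne_root hd, hpar⟩⟩
      have := (toCluster_eq_iff.1 h).1
      omega

theorem dist_le_of_toCluster_eq [Fintype V] {u v : V}
    (h : (toCluster u : Cluster G r) = toCluster v) :
    (G.dist u v : ℝ) ≤
      1 + 2 * hyperbolicity G + 2 * hyperbolicity G * Real.logb 2 (Fintype.card V) := by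
  classical
  obtain ⟨hd, p, hp⟩ := toCluster_eq_iff.1 h
  have hlen : p.bypass.length ≤ 2 ^ (Nat.log 2 (Fintype.card V) + 1) :=
    (p.bypass_isPath.length_lt.trans (Nat.lt_pow_succ_log_self one_lt_two _)).le
  have h1 := gromovProduct_ge_of_walk r _ _ p.bypass hlen
    fun x hx => hp x (p.support_bypass_subset_support hx)
  rw [← hd] at h1
  have h2 := mul_le_mul_of_nonneg_left (Real.natLog_le_logb (Fintype.card V) 2)
    (hyperbolicity_nonneg (G := G))
  push_cast at h1 h2
  linarith

theorem dist_le_of_mem_bag_layeringTreeDecomp [Fintype V] (hG : G.Connected)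
    {i : Cluster G r} {x y : V} (hx : x ∈ (layeringTreeDecomp hG r).bag i)
    (hy : y ∈ (layeringTreeDecomp hG r).bag i) :
    (G.dist x y : ℝ) ≤
      3 + 2 * hyperbolicity G + 2 * hyperbolicity G * Real.logb 2 (Fintype.card V) := by
  have key : ∀ z ∈ (layeringTreeDecomp hG r).bag i, ∃ u, toCluster u = i ∧ G.dist u z ≤ 1 := by
    rintro z (hz | ⟨u, hu, hadj, -⟩)
    · exact ⟨z, hz, by simp⟩
    · exact ⟨u, hu, (SimpleGraph.dist_eq_one_iff_adj.2 hadj).le⟩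
  obtain ⟨a, ha, hax⟩ := key x hx
  obtain ⟨b, hb, hby⟩ := key y hy
  have h1 := dist_le_of_toCluster_eq (ha.trans hb.symm)
  have h2 := hG.dist_triangle (u := x) (v := a) (w := y)
  have h3 := hG.dist_triangle (u := a) (v := b) (w := y)
  rw [G.dist_comm (u := x) (v := a)] at h2
  have h4 : (G.dist x y : ℝ) ≤ G.dist a b + 2 := by
    exact_mod_cast (by omega : G.dist x y ≤ G.dist a b + 2)
  linarith

end Layering

theorem TreeDecomp.length_le {V ι : Type} {G : SimpleGraph V} (D : TreeDecomp G ι) {B : ℝ}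
    (hB : 0 ≤ B) (h : ∀ i, ∀ x ∈ D.bag i, ∀ y ∈ D.bag i, (G.dist x y : ℝ) ≤ B) :
    (D.length : ℝ) ≤ B := by
  refine (Nat.le_floor_iff hB).1 (csSup_le' ?_)
  rintro _ ⟨i, x, y, hx, hy, rfl⟩
  exact Nat.le_floor (h i x hx y hy)

/-- Every finite connected graph on `n` vertices with hyperbolicity `δ` satisfies
`tl(G) ≤ 17 + 12δ + 8δ log₂ n`. -/
theorem treelength_le_of_hyperbolicity {V : Type} [Fintype V]
    (G : SimpleGraph V) (hG : G.Connected) :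
    (treelength G : ℝ) ≤ 17 + 12 * hyperbolicity G +
      8 * hyperbolicity G * Real.logb 2 (Fintype.card V) := by
  obtain ⟨r⟩ := hG.nonempty
  have hδ := hyperbolicity_nonneg (G := G)
  have hlog : 0 ≤ hyperbolicity G * Real.logb 2 (Fintype.card V) :=
    mul_nonneg hδ (Real.logb_nonneg one_lt_two (by exact_mod_cast Fintype.card_pos_iff.2 ⟨r⟩))
  have hle : treelength G ≤ (layeringTreeDecomp hG r).length :=
    Nat.sInf_le ⟨Cluster G r, Fintype.ofFinite _, _, rfl⟩
  have hlen := (layeringTreeDecomp hG r).length_le (by linarith)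
    fun _ _ hx _ hy => dist_le_of_mem_bag_layeringTreeDecomp hG hx hy
  have hle' : (treelength G : ℝ) ≤ (layeringTreeDecomp hG r).length := by exact_mod_cast hle
  linarith
end
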